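/- arXiv:2303.09069 — 2 statements merged into one kernel-verified Lean document; each statement's English description precedes it below -/
import Mathlib

section
/- Theorem (A_{r−1} root-lattice q-binomial identity; appendix identity). Let r ≥ 2, n ≥ 0 and 0 ≤ m ≤ n be integers. Then Σ over y = (y_1,…,y_r) ∈ ℤ^r with y_1+⋯+y_r = 0 of ∏_{1≤i<j≤r} (1 − q^{r(y_i−y_j)+j−i}) · ∏_{i=1}^r q^{C(r+1,2)·y_i² − i y_i} · [n+r−1, n−m−r y_i + i − 1]_q = [n, m]_q · ∏_{i=1}^{r−1} (1 − q^{n+i})^i, as a polynomial identity in q, where C(r+1,2) := r(r+1)/2. (The sum has finite support because the q-binomial coefficients vanish outside their range; the r = 3 case, after the substitution n ↦ n+m, is the bounded A₂ analogue of Euler's pentagonal number theorem.) -/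
noncomputable section

namespace Stmt18

/-- `(a; q)_n`, the finite q-Pochhammer symbol. -/
def qPoch (a q : ℂ) (n : ℕ) : ℂ := ∏ j ∈ Finset.range n, (1 - a * q ^ j)

/-- The q-binomial coefficient, vanishing unless `0 ≤ m ≤ n`. -/
def qBinom (q : ℂ) (n m : ℤ) : ℂ :=
  if 0 ≤ m ∧ m ≤ n then
    qPoch q q n.toNat / (qPoch q q m.toNat * qPoch q q (n - m).toNat)
  else 0

open LaurentPolynomial Finset

theorem coeff_T_mul (p : ℂ[T;T⁻¹]) (a k : ℤ) : (T a * p).coeff k = p.coeff (k - a) := by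
  induction p using LaurentPolynomial.induction_on' with
  | add p q hp hq => rw [mul_add, AddMonoidAlgebra.coeff_add, AddMonoidAlgebra.coeff_add,
      Finsupp.add_apply, Finsupp.add_apply, hp, hq]
  | C_mul_T n b =>
    have h : T a * (C b * T n) = (C b * T (a + n) : ℂ[T;T⁻¹]) := by rw [T_add]; ring
    rw [h, ← single_eq_C_mul_T, ← single_eq_C_mul_T, AddMonoidAlgebra.coeff_single,
      AddMonoidAlgebra.coeff_single, Finsupp.single_apply, Finsupp.single_apply]
    congr 1
    exact propext ⟨fun h => by omega, fun h => by omega⟩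

theorem coeff_C_mul (p : ℂ[T;T⁻¹]) (b : ℂ) (k : ℤ) : (C b * p).coeff k = b * p.coeff k := by
  rw [← smul_eq_C_mul, AddMonoidAlgebra.coeff_smul_apply, smul_eq_mul]

/-- The substitution `T ↦ u T`. -/
def dilate (u : ℂ) (hu : u ≠ 0) : ℂ[T;T⁻¹] →+* ℂ[T;T⁻¹] :=
  (AddMonoidAlgebra.lift ℂ ℂ[T;T⁻¹] ℤ
    { toFun := fun k => C (u ^ k.toAdd) * T k.toAdd
      map_one' := by simp
      map_mul' := fun a b => by
        rw [toAdd_mul, zpow_add₀ hu, map_mul, T_add]; ring }).toRingHom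

theorem dilate_C_mul_T (u : ℂ) (hu : u ≠ 0) (b : ℂ) (n : ℤ) :
    dilate u hu (C b * T n) = C (b * u ^ n) * T n := by
  rw [← single_eq_C_mul_T]
  simp [dilate, smul_eq_C_mul, mul_assoc, -single_eq_C_mul_T]

theorem coeff_dilate (u : ℂ) (hu : u ≠ 0) (p : ℂ[T;T⁻¹]) (k : ℤ) :
    (dilate u hu p).coeff k = u ^ k * p.coeff k := by
  induction p using LaurentPolynomial.induction_on' with
  | add p q hp hq => rw [map_add, AddMonoidAlgebra.coeff_add, AddMonoidAlgebra.coeff_add,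
      Finsupp.add_apply, Finsupp.add_apply, hp, hq, mul_add]
  | C_mul_T n b =>
    rw [dilate_C_mul_T, coeff_C_mul, coeff_C_mul, T_apply]
    split_ifs with h
    · subst h; ring
    · simp

/-- Extract from `c` the coefficients in degrees congruent to `i` modulo `d + 1`, with Gaussian
weights. -/
def slice (q : ℂ) (d : ℕ) (i : ℤ) (c : ℂ[T;T⁻¹]) : ℂ[T;T⁻¹] :=
  .ofCoeff <| Finsupp.ofSupportFinite
    (fun y : ℤ => q ^ (((d : ℤ) + 1) * (y * (y - 1) / 2) - i * y) * c.coeff (i - (d + 1) * y))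
    ((c.coeff.support.finite_toSet.preimage (f := fun y : ℤ => i - (d + 1) * y)
      (fun a _ b _ h => by
        have h' : ((d : ℤ) + 1) * a = (d + 1) * b := by simpa using h
        exact mul_left_cancel₀ (by positivity) h')).subset
      (fun y hy => by
        simp only [Set.mem_preimage, SetLike.mem_coe, Finsupp.mem_support_iff]
        exact right_ne_zero_of_mul hy))

variable {q : ℂ} {d : ℕ}

theorem coeff_slice (i : ℤ) (c : ℂ[T;T⁻¹]) (y : ℤ) : (slice q d i c).coeff y =
    q ^ (((d : ℤ) + 1) * (y * (y - 1) / 2) - i * y) * c.coeff (i - (d + 1) * y) := rfl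

theorem slice_add (i : ℤ) (c c' : ℂ[T;T⁻¹]) :
    slice q d i (c + c') = slice q d i c + slice q d i c' := by
  ext y
  simp only [coeff_slice, AddMonoidAlgebra.coeff_add, Finsupp.add_apply, mul_add]

theorem slice_C_mul (i : ℤ) (b : ℂ) (c : ℂ[T;T⁻¹]) :
    slice q d i (C b * c) = C b * slice q d i c := by
  ext y
  simp only [coeff_slice, coeff_C_mul]
  ring

theorem two_mul_choose (y : ℤ) : 2 * (y * (y - 1) / 2) = y * (y - 1) :=
  Int.mul_ediv_cancel' (by
    rcases Int.even_or_odd' y with ⟨k, rfl | rfl⟩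
    · exact ⟨k * (2 * k - 1), by ring⟩
    · exact ⟨(2 * k + 1) * k, by ring⟩)

theorem slice_succ_T_mul (hq : q ≠ 0) (i : ℤ) (c : ℂ[T;T⁻¹]) :
    slice q d (i + 1) (T 1 * c) = dilate q⁻¹ (inv_ne_zero hq) (slice q d i c) := by
  ext y
  rw [coeff_slice, coeff_dilate, coeff_slice, coeff_T_mul, ← mul_assoc, inv_zpow', ← zpow_add₀ hq]
  ring_nf

theorem slice_add_period (hq : q ≠ 0) (i : ℤ) (c : ℂ[T;T⁻¹]) :
    slice q d (i + (d + 1)) c = C (q ^ (-(i + (d + 1)))) * (T 1 * slice q d i c) := by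
  ext y
  rw [coeff_slice, coeff_C_mul, coeff_T_mul, coeff_slice, ← mul_assoc, ← zpow_add₀ hq]
  have h1 := two_mul_choose y
  have h2 := two_mul_choose (y - 1)
  congr 2
  · generalize y * (y - 1) / 2 = A at *
    generalize (y - 1) * (y - 1 - 1) / 2 = B at *
    have : A = B + y - 1 := by linarith
    subst this; ring
  · ring_nf

theorem slice_dilate (hq : q ≠ 0) (i : ℤ) (c : ℂ[T;T⁻¹]) :
    slice q d i (dilate q hq c) =
      C (q ^ (-((d : ℤ) + 1))) * (T 1 * slice q d i (T (d + 1) * c)) := by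
  ext y
  rw [coeff_slice, coeff_C_mul, coeff_T_mul, coeff_slice, coeff_dilate, coeff_T_mul, ← mul_assoc,
    ← mul_assoc, ← zpow_add₀ hq, ← zpow_add₀ hq]
  have h1 := two_mul_choose y
  have h2 := two_mul_choose (y - 1)
  congr 2
  · generalize y * (y - 1) / 2 = A at *
    generalize (y - 1) * (y - 1 - 1) / 2 = B at *
    have : A = B + y - 1 := by linarith
    subst this; ring
  · ring_nf

theorem slice_dilate' (hq : q ≠ 0) (i : ℤ) (c : ℂ[T;T⁻¹]) :
    slice q d i (dilate q hq c) =
      C (q ^ i) * dilate (q ^ (-((d : ℤ) + 1))) (zpow_ne_zero _ hq) (slice q d i c) := by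
  ext y
  rw [coeff_slice, coeff_C_mul, coeff_dilate, coeff_dilate, coeff_slice, ← zpow_mul,
    ← mul_assoc, ← mul_assoc, ← mul_assoc, ← zpow_add₀ hq, ← zpow_add₀ hq, ← zpow_add₀ hq]
  congr 2
  ring

variable (q d) in
/-- The matrix of the slices of the shifts of `c`. -/
def sliceMatrix (c : ℂ[T;T⁻¹]) : Matrix (Fin (d + 1)) (Fin (d + 1)) ℂ[T;T⁻¹] :=
  .of fun i j => slice q d (i : ℕ) (T (j : ℕ) * c)

theorem det_sliceMatrix_updateCol_dilate (hq : q ≠ 0) (c : ℂ[T;T⁻¹]) :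
    ((sliceMatrix q d c).updateCol 0 fun i => slice q d (i : ℕ) (dilate q hq c)).det =
      dilate q⁻¹ (inv_ne_zero hq) (sliceMatrix q d c).det := by
  have key : ∀ x : ℂ[T;T⁻¹], ∃ v : Fin (d + 1) → ℂ[T;T⁻¹],
      v (Fin.last d) = x ∧ ∀ i : Fin d, v i.castSucc = 1 := fun x =>
    ⟨fun i => Fin.lastCases x (fun _ => 1) i, by simp, by simp⟩
  obtain ⟨v, hv_last, hv_cast⟩ := key (C (q ^ (-((d : ℤ) + 1))) * T 1)
  obtain ⟨w, hw_last, hw_cast⟩ := key (C (q ^ ((d : ℤ) + 1)) * T (-1))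
  have hcol : ∀ i j : Fin (d + 1),
      (sliceMatrix q d c).updateCol 0 (fun i => slice q d (i : ℕ) (dilate q hq c)) i
        (finRotate _ j) = v j * slice q d (i : ℕ) (T 1 * (T (j : ℕ) * c)) := by
    intro i j
    induction j using Fin.lastCases with
    | last =>
      rw [finRotate_last, Matrix.updateCol_self, slice_dilate hq, hv_last,
        ← mul_assoc (T 1) (T _) c, ← T_add, mul_assoc]
      simp [add_comm]
    | cast j =>
      have : finRotate (d + 1) j.castSucc = j.succ := by simp
      rw [this, Matrix.updateCol_ne (Fin.succ_ne_zero j), hv_cast, one_mul,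
        ← mul_assoc (T 1) (T _) c, ← T_add]
      simp [sliceMatrix, add_comm]
  have hrow : ∀ (i : Fin (d + 1)) (b : ℂ[T;T⁻¹]),
      slice q d ((finRotate _ i : Fin (d + 1)) : ℕ) (T 1 * b) =
        w i * dilate q⁻¹ (inv_ne_zero hq) (slice q d (i : ℕ) b) := by
    intro i b
    induction i using Fin.lastCases with
    | last =>
      have h : slice q d ((Fin.last d : ℕ) : ℤ) b =
          C (q ^ (-(d : ℤ))) * (T 1 * slice q d (-1) b) := by
        have := slice_add_period (d := d) hq (-1) b
        simpa using this
      have h1 : ((0 : Fin (d + 1)) : ℕ) = ((-1 : ℤ) + 1) := by simp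
      rw [finRotate_last, h1, slice_succ_T_mul hq, h, hw_last, ← mul_assoc (C _),
        map_mul, dilate_C_mul_T]
      have : (C (q ^ ((d : ℤ) + 1)) * T (-1) : ℂ[T;T⁻¹]) *
          (C (q ^ (-(d : ℤ)) * q⁻¹ ^ (1 : ℤ)) * T 1) = 1 := by
        rw [mul_mul_mul_comm, ← map_mul, ← T_add, zpow_neg, zpow_add₀ hq]
        field_simp
        simp
      rw [← mul_assoc, this, one_mul]
    | cast i =>
      have : finRotate (d + 1) i.castSucc = i.succ := by simp
      rw [this, hw_cast, one_mul, ← slice_succ_T_mul hq]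
      simp
  have hvw : (∏ j, v j) * ∏ i, w i = 1 := by
    rw [Fin.prod_univ_castSucc, Fin.prod_univ_castSucc]
    simp only [hv_last, hv_cast, hw_last, hw_cast, prod_const_one, one_mul]
    rw [mul_mul_mul_comm, ← map_mul, ← T_add, ← zpow_add₀ hq]
    simp
  rw [← Matrix.det_submatrix_equiv_self (finRotate (d + 1))]
  have hM : ((sliceMatrix q d c).updateCol 0 fun i => slice q d (i : ℕ) (dilate q hq c)).submatrix
      (finRotate (d + 1)) (finRotate (d + 1)) = .of fun i j => v j *
        (Matrix.of fun i j => w i * (sliceMatrix q d c).map (dilate q⁻¹ (inv_ne_zero hq)) i j)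
          i j := by
    ext1 i j
    simp only [Matrix.submatrix_apply, hcol, hrow, Matrix.of_apply, Matrix.map_apply]
    rfl
  rw [hM, Matrix.det_mul_row, Matrix.det_mul_column, ← mul_assoc, hvw, one_mul,
    ← RingHom.mapMatrix_apply, ← RingHom.map_det]

theorem det_sliceMatrix_dilate (hq : q ≠ 0) (c : ℂ[T;T⁻¹]) :
    (sliceMatrix q d (dilate q hq c)).det =
      dilate (q ^ (-((d : ℤ) + 1))) (zpow_ne_zero _ hq) (sliceMatrix q d c).det := by
  have hM : sliceMatrix q d (dilate q hq c) = .of fun i j : Fin (d + 1) => C (q ^ (-((j : ℕ) : ℤ))) *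
      (Matrix.of fun i j : Fin (d + 1) => C (q ^ ((i : ℕ) : ℤ)) * (sliceMatrix q d c).map
        (dilate (q ^ (-((d : ℤ) + 1))) (zpow_ne_zero _ hq)) i j) i j := by
    ext1 i j
    simp only [sliceMatrix, Matrix.of_apply, Matrix.map_apply]
    rw [← slice_dilate' hq, ← slice_C_mul]
    congr 1
    ext k
    rw [coeff_T_mul, coeff_dilate, coeff_C_mul, coeff_dilate, coeff_T_mul, ← mul_assoc,
      ← zpow_add₀ hq]
    ring_nf
  rw [hM, Matrix.det_mul_row, Matrix.det_mul_column, ← mul_assoc, ← prod_mul_distrib]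
  simp_rw [← map_mul, ← zpow_add₀ hq]
  simp only [neg_add_cancel, zpow_zero, map_one, prod_const_one, one_mul]
  rw [← RingHom.mapMatrix_apply, ← RingHom.map_det]

theorem sliceMatrix_C_mul (b : ℂ) (c : ℂ[T;T⁻¹]) :
    sliceMatrix q d (C b * c) = C b • sliceMatrix q d c := by
  ext1 i j
  simp only [sliceMatrix, Matrix.of_apply, Matrix.smul_apply, smul_eq_mul, ← slice_C_mul]
  ring_nf

/-- The finite product `(-T; q)_n`. -/
def qProd (q : ℂ) (n : ℕ) : ℂ[T;T⁻¹] := ∏ l ∈ range n, (1 + C (q ^ l) * T 1)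

theorem qProd_succ (n : ℕ) : qProd q (n + 1) = qProd q n * (1 + C (q ^ n) * T 1) :=
  prod_range_succ _ _

theorem dilate_qProd (hq : q ≠ 0) (n : ℕ) :
    dilate q hq (qProd q n) = ∏ l ∈ range n, (1 + C (q ^ (l + 1)) * T 1) := by
  rw [qProd, map_prod]
  refine prod_congr rfl fun l _ => ?_
  rw [map_add, map_one, dilate_C_mul_T, zpow_one, pow_succ]

theorem qProd_succ' (hq : q ≠ 0) (n : ℕ) :
    qProd q (n + 1) = (1 + T 1) * dilate q hq (qProd q n) := by
  rw [dilate_qProd, qProd, prod_range_succ', pow_zero, map_one, one_mul, mul_comm]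

theorem dilate_qProd_succ (hq : q ≠ 0) (n : ℕ) :
    dilate q hq (qProd q (n + 1)) =
      qProd q (n + 1) - C (1 - q ^ (n + 1)) * (T 1 * dilate q hq (qProd q n)) := by
  rw [dilate_qProd, prod_range_succ, ← dilate_qProd hq, qProd_succ' hq, map_sub, map_one]
  ring

theorem dilate_T_mul (hq : q ≠ 0) (k : ℤ) (c : ℂ[T;T⁻¹]) :
    dilate q hq (T k * c) = C (q ^ k) * (T k * dilate q hq c) := by
  rw [map_mul, ← one_mul (T k), ← map_one C, dilate_C_mul_T, map_one, one_mul, one_mul, mul_assoc]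

theorem det_sliceMatrix_one_add_T (c : ℂ[T;T⁻¹]) :
    ((sliceMatrix q d ((1 + T 1) * c)).updateCol 0 fun i => slice q d (i : ℕ) (T 1 * c)).det =
      (sliceMatrix q d (T 1 * c)).det := by
  symm
  refine Matrix.det_eq_of_forall_col_eq_smul_add_pred (fun _ => -1) (fun i => ?_) fun i j => ?_
  · simp [sliceMatrix]
  · have h : T ((j.succ : ℕ) : ℤ) * ((1 + T 1) * c) =
        T ((j.succ : ℕ) : ℤ) * (T 1 * c) + T ((j.castSucc : ℕ) : ℤ) * (T 1 * c) := by
      simp only [Fin.val_succ, Fin.val_castSucc, Nat.cast_add, Nat.cast_one, T_add]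
      ring
    rw [Matrix.updateCol_ne (Fin.succ_ne_zero j)]
    simp only [sliceMatrix, Matrix.of_apply]
    rw [h, slice_add]
    ring

theorem coeff_zero_det_sliceMatrix_qProd_succ (hq : q ≠ 0) (n : ℕ) (k : ℤ) :
    (1 - q ^ k) * (sliceMatrix q d (T (-k) * qProd q (n + 1))).det.coeff 0 =
      (1 - q ^ (n + 1)) * (q ^ ((k - 1) * (d + 1)) *
        (sliceMatrix q d (T (-(k - 1)) * qProd q n)).det.coeff 0) := by
  set c := T (-k) * qProd q (n + 1) with hc
  set b := T (-k) * dilate q hq (qProd q n) with hb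
  have h1 : dilate q hq c = C (q ^ (-k)) * (c + C (-(1 - q ^ (n + 1))) * (T 1 * b)) := by
    rw [hc, hb, dilate_T_mul, dilate_qProd_succ, map_neg]
    ring
  have h2 : c = (1 + T 1) * b := by rw [hc, hb, qProd_succ' hq]; ring
  have h3 : T 1 * b = C (q ^ (k - 1)) * dilate q hq (T (-(k - 1)) * qProd q n) := by
    rw [dilate_T_mul, ← mul_assoc (C _) (C _), ← map_mul, ← zpow_add₀ hq, hb,
      ← mul_assoc, ← T_add, add_neg_cancel, zpow_zero, map_one, one_mul]
    congr 2
    ring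
  have h4 : (fun i : Fin (d + 1) => slice q d (i : ℕ) (dilate q hq c)) =
      C (q ^ (-k)) • ((fun i : Fin (d + 1) => slice q d (i : ℕ) c) +
        C (-(1 - q ^ (n + 1))) • fun i : Fin (d + 1) => slice q d (i : ℕ) (T 1 * b)) := by
    ext1 i
    simp only [h1, slice_C_mul, slice_add, Pi.smul_apply, Pi.add_apply, smul_eq_mul]
  have h5 : ((sliceMatrix q d c).updateCol 0 fun i => slice q d (i : ℕ) c) = sliceMatrix q d c := by
    refine Eq.trans ?_ (Matrix.updateCol_eq_self (sliceMatrix q d c) 0)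
    congr 1
    ext1 i
    simp [sliceMatrix]
  have h6 := congrArg (fun p => p.coeff 0) (det_sliceMatrix_updateCol_dilate (d := d) hq c)
  rw [h4, Matrix.det_updateCol_smul, Matrix.det_updateCol_add, Matrix.det_updateCol_smul, h5] at h6
  nth_rewrite 2 [h2] at h6
  rw [det_sliceMatrix_one_add_T, h3, sliceMatrix_C_mul, Matrix.det_smul, det_sliceMatrix_dilate,
    ← map_pow] at h6
  simp only [coeff_C_mul, coeff_dilate, AddMonoidAlgebra.coeff_add, Finsupp.add_apply, zpow_zero,
    one_mul, Fintype.card_fin] at h6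
  rw [zpow_neg, inv_mul_eq_iff_eq_mul₀ (zpow_ne_zero _ hq)] at h6
  rw [zpow_mul, ← Nat.cast_add_one, zpow_natCast]
  linear_combination h6

theorem coeff_det_zero {m : ℕ} (M : Matrix (Fin m) (Fin m) ℂ[T;T⁻¹]) (S : Finset ℤ)
    (hS : ∀ i j, (M i j).coeff.support ⊆ S) :
    M.det.coeff 0 = ∑ y ∈ Fintype.piFinset (fun _ : Fin m => S) with ∑ i, y i = 0,
      (Matrix.of fun i j => (M i j).coeff (y i)).det := by
  have hM : ∀ i j, M i j = ∑ y ∈ S, C ((M i j).coeff y) * T y := by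
    intro i j
    ext k
    simp only [AddMonoidAlgebra.coeff_sum, Finsupp.finsetSum_apply, coeff_C_mul, T_apply,
      mul_ite, mul_one, mul_zero, sum_ite_eq']
    split_ifs with h
    · rfl
    · exact Finsupp.notMem_support_iff.mp fun h' => h (hS i j h')
  have hprod : ∀ σ : Equiv.Perm (Fin m), (∏ i, M i (σ i)).coeff 0 =
      ∑ y ∈ Fintype.piFinset (fun _ : Fin m => S) with ∑ i, y i = 0,
        ∏ i, (M i (σ i)).coeff (y i) := by
    intro σ
    have hT : ∀ y : Fin m → ℤ, ∏ i, (T (y i) : ℂ[T;T⁻¹]) = T (∑ i, y i) := fun y => by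
      induction (univ : Finset (Fin m)) using Finset.induction_on with
      | empty => simp
      | insert i s hi ih => rw [prod_insert hi, sum_insert hi, ih, T_add]
    rw [prod_congr rfl fun i _ => hM i (σ i), prod_univ_sum, AddMonoidAlgebra.coeff_sum,
      Finsupp.finsetSum_apply, sum_filter]
    refine sum_congr rfl fun y _ => ?_
    rw [prod_mul_distrib, ← map_prod, hT, coeff_C_mul, T_apply, mul_ite, mul_one, mul_zero]
  rw [← Matrix.det_transpose, Matrix.det_apply, AddMonoidAlgebra.coeff_sum,
    Finsupp.finsetSum_apply]
  simp_rw [← Matrix.det_transpose (Matrix.of _), Matrix.det_apply]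
  rw [sum_comm]
  refine sum_congr rfl fun σ _ => ?_
  rw [← smul_sum]
  simp only [Matrix.transpose_apply, Matrix.of_apply]
  rw [← hprod σ]
  rcases Int.units_eq_one_or (Equiv.Perm.sign σ) with h | h <;> simp [h]

theorem qPoch_self_succ (n : ℕ) : qPoch q q (n + 1) = qPoch q q n * (1 - q ^ (n + 1)) := by
  rw [qPoch, prod_range_succ, qPoch, pow_succ']

theorem qPoch_self_ne_zero (hq1 : ∀ i : ℕ, 0 < i → q ^ i ≠ 1) (n : ℕ) : qPoch q q n ≠ 0 :=
  prod_ne_zero_iff.mpr fun j _ => by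
    rw [← pow_succ']
    exact sub_ne_zero.mpr (hq1 _ j.succ_pos).symm

theorem qBinom_of_lt {n k : ℤ} (h : k < 0 ∨ n < k) : qBinom q n k = 0 :=
  if_neg (by omega)

theorem qBinom_add (a b : ℕ) :
    qBinom q ((a : ℤ) + b) a = qPoch q q (a + b) / (qPoch q q a * qPoch q q b) := by
  rw [qBinom, if_pos (by omega)]
  congr
  omega

theorem qBinom_zero_right (hq1 : ∀ i : ℕ, 0 < i → q ^ i ≠ 1) (n : ℕ) : qBinom q n 0 = 1 := by
  have h := qBinom_add (q := q) 0 n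
  have h0 : qPoch q q 0 = 1 := prod_range_zero _
  rwa [Nat.cast_zero, zero_add, zero_add, h0, one_mul, div_self (qPoch_self_ne_zero hq1 n)] at h

theorem qBinom_succ (hq1 : ∀ i : ℕ, 0 < i → q ^ i ≠ 1) (n : ℕ) (k : ℤ) :
    qBinom q ((n : ℤ) + 1) k = qBinom q n k + q ^ ((n : ℤ) + 1 - k) * qBinom q n (k - 1) := by
  rcases lt_trichotomy k 0 with hk | rfl | hk
  · rw [qBinom_of_lt (Or.inl hk), qBinom_of_lt (Or.inl hk), qBinom_of_lt (by omega)]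
    simp
  · have h := qBinom_zero_right hq1 (n + 1)
    rw [Nat.cast_add_one] at h
    rw [h, qBinom_zero_right hq1, qBinom_of_lt (by omega), mul_zero, add_zero]
  · obtain ⟨a, rfl⟩ : ∃ a : ℕ, k = a + 1 := ⟨(k - 1).toNat, by omega⟩
    rw [add_sub_cancel_right]
    rcases lt_trichotomy a n with ha | rfl | ha
    · obtain ⟨b, rfl⟩ : ∃ b : ℕ, n = a + (b + 1) := ⟨n - a - 1, by omega⟩
      have h1 := qBinom_add (q := q) (a + 1) (b + 1)
      have h2 := qBinom_add (q := q) (a + 1) b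
      have h3 := qBinom_add (q := q) a (b + 1)
      have e1 : ((a + (b + 1) : ℕ) : ℤ) + 1 = ((a + 1 : ℕ) : ℤ) + ((b + 1 : ℕ) : ℤ) := by
        push_cast; ring
      have e2 : ((a + (b + 1) : ℕ) : ℤ) = ((a + 1 : ℕ) : ℤ) + b := by push_cast; ring
      have e3 : ((a + (b + 1) : ℕ) : ℤ) = (a : ℤ) + ((b + 1 : ℕ) : ℤ) := by push_cast; ring
      have e4 : ((a + (b + 1) : ℕ) : ℤ) + 1 - (a + 1) = ((b + 1 : ℕ) : ℤ) := by push_cast; ring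
      rw [e4, e1]
      nth_rewrite 2 [e3]
      rw [e2, ← Nat.cast_succ a, h1, h2, h3, zpow_natCast]
      have : a + 1 + (b + 1) = a + b + 1 + 1 := by ring
      rw [this, show a + 1 + b = a + b + 1 by ring, show a + (b + 1) = a + b + 1 by ring,
        qPoch_self_succ (a + b + 1), qPoch_self_succ a, qPoch_self_succ b]
      have ha := qPoch_self_ne_zero hq1 a
      have hb := qPoch_self_ne_zero hq1 b
      have ha1 : 1 - q ^ (a + 1) ≠ 0 := sub_ne_zero.mpr (hq1 _ a.succ_pos).symm
      have hb1 : 1 - q ^ (b + 1) ≠ 0 := sub_ne_zero.mpr (hq1 _ b.succ_pos).symm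
      field_simp
      ring
    · have h1 := qBinom_add (q := q) (a + 1) 0
      have h2 := qBinom_add (q := q) a 0
      have := qPoch_self_ne_zero hq1 a
      have := qPoch_self_ne_zero hq1 (a + 1)
      have h0 : qPoch q q 0 = 1 := prod_range_zero _
      rw [qBinom_of_lt (n := a) (k := a + 1) (by omega)]
      simp only [Nat.cast_zero, add_zero, Nat.cast_add, Nat.cast_one, h0, mul_one] at h1 h2
      rw [h1, h2]
      field_simp
      simp
    · rw [qBinom_of_lt (by omega), qBinom_of_lt (by omega), qBinom_of_lt (by omega)]
      simp

theorem qBinom_succ_succ_mul (hq1 : ∀ i : ℕ, 0 < i → q ^ i ≠ 1) {n k : ℕ} (h : k ≤ n) :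
    (1 - q ^ (k + 1)) * qBinom q ((n : ℤ) + 1) (k + 1) = (1 - q ^ (n + 1)) * qBinom q n k := by
  obtain ⟨b, rfl⟩ := Nat.exists_eq_add_of_le h
  have h1 := qBinom_add (q := q) (k + 1) b
  have h2 := qBinom_add (q := q) k b
  have e1 : ((k + b : ℕ) : ℤ) + 1 = ((k + 1 : ℕ) : ℤ) + b := by push_cast; ring
  rw [e1, ← Nat.cast_succ k, h1, Nat.cast_add k b, h2, show k + 1 + b = k + b + 1 by ring,
    qPoch_self_succ, qPoch_self_succ k]
  have ha := qPoch_self_ne_zero hq1 k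
  have hb := qPoch_self_ne_zero hq1 b
  have ha1 : 1 - q ^ (k + 1) ≠ 0 := sub_ne_zero.mpr (hq1 _ k.succ_pos).symm
  field_simp

theorem qBinom_symm {n m : ℕ} (h : m ≤ n) : qBinom q n ((n : ℤ) - m) = qBinom q n m := by
  obtain ⟨b, rfl⟩ := Nat.exists_eq_add_of_le h
  have h1 := qBinom_add (q := q) b m
  have h2 := qBinom_add (q := q) m b
  rw [Nat.cast_add, add_sub_cancel_left, h2, add_comm (m : ℤ), h1, add_comm b, mul_comm]

theorem coeff_qProd (hq : q ≠ 0) (hq1 : ∀ i : ℕ, 0 < i → q ^ i ≠ 1) (n : ℕ) (k : ℤ) :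
    (qProd q n).coeff k = q ^ (k * (k - 1) / 2) * qBinom q n k := by
  induction n generalizing k with
  | zero =>
    have h1 : qProd q 0 = C 1 := by simp [qProd]
    rw [h1, C_apply]
    split_ifs with h
    · subst h
      simp [qBinom, qPoch]
    · rw [qBinom_of_lt (by omega), mul_zero]
  | succ n ih =>
    have h1 : qProd q (n + 1) = qProd q n + C (q ^ n) * (T 1 * qProd q n) := by
      rw [qProd_succ]; ring
    rw [h1, AddMonoidAlgebra.coeff_add, Finsupp.add_apply, coeff_C_mul, coeff_T_mul, ih, ih,
      Nat.cast_succ, qBinom_succ hq1, mul_add, ← mul_assoc, ← mul_assoc, ← zpow_add₀ hq,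
      ← zpow_natCast, ← zpow_add₀ hq]
    congr 3
    have e1 := two_mul_choose k
    have e2 := two_mul_choose (k - 1)
    generalize k * (k - 1) / 2 = A at *
    generalize (k - 1) * (k - 1 - 1) / 2 = B at *
    linarith

theorem coeff_zero_det_sliceMatrix_qProd_zero (hq : q ≠ 0)
    (hq1 : ∀ i : ℕ, 0 < i → q ^ i ≠ 1) (n : ℕ) :
    (sliceMatrix q d (qProd q n)).det.coeff 0 = 1 := by
  have hneg : ∀ k < 0, (qProd q n).coeff k = 0 := fun k hk => by
    rw [coeff_qProd hq hq1, qBinom_of_lt (Or.inl hk), mul_zero]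
  have hone : (qProd q n).coeff 0 = 1 := by
    rw [coeff_qProd hq hq1, qBinom_zero_right hq1]
    simp
  have hcoeff : ∀ (i j : Fin (d + 1)) (y : ℤ), (sliceMatrix q d (qProd q n) i j).coeff y =
      q ^ (((d : ℤ) + 1) * (y * (y - 1) / 2) - (i : ℕ) * y) *
        (qProd q n).coeff ((i : ℕ) - (d + 1) * y - (j : ℕ)) := fun i j y => by
    rw [sliceMatrix, Matrix.of_apply, coeff_slice, coeff_T_mul]
  have hpos : ∀ (i j : Fin (d + 1)) (y : ℤ), 0 < y →
      (sliceMatrix q d (qProd q n) i j).coeff y = 0 := fun i j y hy => by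
    rw [hcoeff, hneg, mul_zero]
    have := i.isLt
    nlinarith
  rw [coeff_det_zero _ (insert 0 (univ.biUnion fun i => univ.biUnion fun j =>
      (sliceMatrix q d (qProd q n) i j).coeff.support)) fun i j =>
    Subset.trans (Subset.trans (subset_biUnion_of_mem
      (fun j => (sliceMatrix q d (qProd q n) i j).coeff.support) (mem_univ j))
      (subset_biUnion_of_mem (fun i => univ.biUnion fun j =>
        (sliceMatrix q d (qProd q n) i j).coeff.support) (mem_univ i))) (subset_insert _ _)]
  rw [sum_eq_single_of_mem 0 (by simp)]
  · rw [Matrix.det_of_isLowerTriangular]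
    · refine prod_eq_one fun i _ => ?_
      simp [hcoeff, hone]
    · intro i j hij
      simp only [Matrix.of_apply, hcoeff, Pi.zero_apply]
      rw [hneg, mul_zero]
      have : (i : ℕ) < (j : ℕ) := hij
      omega
  · intro y hy hy0
    obtain ⟨i, hi⟩ : ∃ i, 0 < y i := by
      by_contra! h
      exact hy0 (funext fun i => (sum_eq_zero_iff_of_nonpos fun i _ => h i).mp
        (mem_filter.mp hy).2 i (mem_univ i))
    exact Matrix.det_eq_zero_of_row_eq_zero i fun j => hpos i j _ hi

theorem coeff_zero_det_sliceMatrix_qProd (hq : q ≠ 0) (hq1 : ∀ i : ℕ, 0 < i → q ^ i ≠ 1)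
    (n k : ℕ) (h : k ≤ n) : (sliceMatrix q d (T (-k) * qProd q n)).det.coeff 0 =
      q ^ (((d : ℤ) + 1) * ((k : ℤ) * (k - 1) / 2)) * qBinom q n k := by
  induction k generalizing n with
  | zero =>
    simp [coeff_zero_det_sliceMatrix_qProd_zero hq hq1, qBinom_zero_right hq1]
  | succ k ih =>
    obtain ⟨n, rfl⟩ : ∃ m, n = m + 1 := ⟨n - 1, by omega⟩
    have h1 := coeff_zero_det_sliceMatrix_qProd_succ (d := d) hq n ((k + 1 : ℕ) : ℤ)
    have hk : 1 - q ^ (k + 1) ≠ 0 := sub_ne_zero.mpr (hq1 _ k.succ_pos).symm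
    rw [show ((k + 1 : ℕ) : ℤ) - 1 = k by simp, ih n (by omega), zpow_natCast] at h1
    refine mul_left_cancel₀ hk (h1.trans ?_)
    rw [mul_left_comm (1 - q ^ (k + 1)), Nat.cast_succ n, Nat.cast_succ k,
      qBinom_succ_succ_mul hq1 (by omega), ← mul_assoc (q ^ _) (q ^ _), ← zpow_add₀ hq,
      mul_left_comm]
    congr 2
    have e1 := two_mul_choose k
    have e2 := two_mul_choose (k + 1)
    generalize (k : ℤ) * (k - 1) / 2 = A at *
    generalize ((k : ℤ) + 1) * (k + 1 - 1) / 2 = B at *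
    have : B = A + k := by linarith
    subst this
    ring

variable (q) in
/-- The polynomials `g` with `qProd q (n + d)` dilated by `q ^ (-j)` equal to `qProd q n * g`. -/
def connPoly (n d j : ℕ) : Polynomial ℂ :=
  (∏ l ∈ range j, (1 + Polynomial.C (q ^ ((l : ℤ) - j)) * Polynomial.X)) *
    ∏ l ∈ range (d - j), (1 + Polynomial.C (q ^ (n + l)) * Polynomial.X)

theorem natDegree_connPoly_le {n j : ℕ} (h : j ≤ d) : (connPoly q n d j).natDegree ≤ d := by
  have hlin : ∀ b : ℂ, (1 + Polynomial.C b * Polynomial.X).natDegree ≤ 1 := fun b => by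
    compute_degree
  have hprod : ∀ (m : ℕ) (b : ℕ → ℂ),
      (∏ l ∈ range m, (1 + Polynomial.C (b l) * Polynomial.X)).natDegree ≤ m := fun m b =>
    (Polynomial.natDegree_prod_le _ _).trans
      ((sum_le_sum fun l _ => hlin (b l)).trans (by simp))
  exact Polynomial.natDegree_mul_le.trans
    ((add_le_add (hprod _ _) (hprod _ _)).trans (by omega))

theorem dilate_qProd_eq_mul_connPoly (hq : q ≠ 0) {n j : ℕ} (h : j ≤ d) :
    dilate (q ^ (-(j : ℤ))) (zpow_ne_zero _ hq) (qProd q (n + d)) =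
      qProd q n * Polynomial.toLaurent (connPoly q n d j) := by
  have hd : n + d = j + (n + (d - j)) := by omega
  have hlin : ∀ a b : ℂ, a * q ^ (-(j : ℤ)) = b →
      dilate (q ^ (-(j : ℤ))) (zpow_ne_zero _ hq) (1 + C a * T 1) = 1 + C b * T 1 := by
    rintro a _ rfl
    rw [map_add, map_one, dilate_C_mul_T, zpow_one]
  have hlaurent : ∀ b : ℂ, Polynomial.toLaurent (1 + Polynomial.C b * Polynomial.X) =
      1 + C b * T 1 := fun b => by
    rw [map_add, map_one, map_mul, Polynomial.toLaurent_C, Polynomial.toLaurent_X]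
  rw [hd, qProd, map_prod, prod_range_add, prod_range_add, mul_left_comm, connPoly, map_mul,
    map_prod, map_prod, qProd]
  simp only [hlaurent]
  refine congrArg₂ _ (prod_congr rfl fun l _ => hlin _ _ ?_)
    (congrArg₂ _ (prod_congr rfl fun l _ => hlin _ _ ?_) (prod_congr rfl fun l _ => hlin _ _ ?_))
  · rw [← zpow_natCast, ← zpow_natCast, ← zpow_add₀ hq]
    congr 1
    push_cast
    ring
  · rw [← zpow_natCast, ← zpow_add₀ hq, sub_eq_add_neg]
  · rw [← zpow_natCast, ← zpow_natCast, ← zpow_add₀ hq]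
    congr 1
    push_cast
    ring

theorem coeff_mul_toLaurent (c : ℂ[T;T⁻¹]) (p : Polynomial ℂ) (hp : p.natDegree ≤ d) (k : ℤ) :
    (c * Polynomial.toLaurent p).coeff k =
      ∑ l : Fin (d + 1), c.coeff (k - (l : ℕ)) * p.coeff l := by
  rw [Fin.sum_univ_eq_sum_range fun l : ℕ => c.coeff (k - l) * p.coeff l]
  conv_lhs => rw [p.as_sum_range_C_mul_X_pow' (n := d + 1) (by omega)]
  rw [map_sum, mul_sum, AddMonoidAlgebra.coeff_sum, Finsupp.finsetSum_apply]
  refine sum_congr rfl fun l _ => ?_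
  rw [Polynomial.toLaurent_C_mul_X_pow, mul_left_comm, coeff_C_mul, mul_comm c, coeff_T_mul,
    mul_comm]

theorem connPoly_succ_sub (hq : q ≠ 0) {n j : ℕ} (h : j ≤ d) :
    connPoly q n (d + 1) (j + 1) - connPoly q n (d + 1) j =
      Polynomial.C (q ^ (-((j : ℤ) + 1)) * (1 - q ^ (n + d + 1))) *
        (Polynomial.X * connPoly q n d j) := by
  have h1 : d + 1 - (j + 1) = d - j := by omega
  have h2 : d + 1 - j = d - j + 1 := by omega
  have h3 : ∀ l : ℕ, ((l + 1 : ℕ) : ℤ) - ((j + 1 : ℕ) : ℤ) = l - j := fun l => by push_cast; ring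
  have h4 : ((0 : ℕ) : ℤ) - ((j + 1 : ℕ) : ℤ) = -((j : ℤ) + 1) := by push_cast; ring
  have h5 : q ^ (-((j : ℤ) + 1)) * (1 - q ^ (n + d + 1)) =
      q ^ (-((j : ℤ) + 1)) - q ^ (n + (d - j)) := by
    rw [mul_sub, mul_one, ← zpow_natCast, ← zpow_natCast, ← zpow_add₀ hq]
    congr 2
    push_cast [h]
    ring
  simp only [connPoly, h1, h2]
  rw [prod_range_succ', prod_range_succ _ (d - j), h5, map_sub]
  simp only [h3, h4]
  ring

variable (q) in
/-- The matrix of the coefficients of the polynomials `connPoly q n d j`. -/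
def connMatrix (n d : ℕ) : Matrix (Fin (d + 1)) (Fin (d + 1)) ℂ :=
  .of fun k j => (connPoly q n d j).coeff k

theorem det_connMatrix_succ (hq : q ≠ 0) (n : ℕ) : (connMatrix q n (d + 1)).det =
    (∏ j ∈ range (d + 1), (q ^ (-((j : ℤ) + 1)) * (1 - q ^ (n + d + 1)))) *
      (connMatrix q n d).det := by
  let B : Matrix (Fin (d + 2)) (Fin (d + 2)) ℂ := .of fun k j => Fin.cases
    ((connPoly q n (d + 1) 0).coeff k)
    (fun j => (connPoly q n (d + 1) ((j : ℕ) + 1) - connPoly q n (d + 1) j).coeff k) j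
  have hB : (connMatrix q n (d + 1)).det = B.det :=
    Matrix.det_eq_of_forall_col_eq_smul_add_pred (fun _ => 1) (fun i => rfl) fun i j => by
      simp [connMatrix, B]
  have hsucc : ∀ k (j : Fin (d + 1)), B k j.succ = q ^ (-((j : ℤ) + 1)) * (1 - q ^ (n + d + 1)) *
      (Polynomial.X * connPoly q n d j).coeff k := fun k j => by
    simp only [B, Matrix.of_apply, Fin.cases_succ]
    rw [connPoly_succ_sub hq (Nat.lt_succ_iff.mp j.isLt), Polynomial.coeff_C_mul]
  have hzero : B 0 0 = 1 := by
    simp [B, connPoly, Polynomial.coeff_zero_eq_eval_zero, Polynomial.eval_prod]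
  rw [hB, Matrix.det_succ_row_zero, Fin.sum_univ_succ, sum_eq_zero fun j _ => by
    rw [hsucc]; simp, hzero, add_zero, ← Fin.prod_univ_eq_prod_range, ← Matrix.det_mul_row]
  simp only [Fin.val_zero, pow_zero, one_mul]
  congr 1
  ext1 i j
  rw [Matrix.submatrix_apply, Fin.zero_succAbove, hsucc]
  simp [connMatrix]

theorem prod_zpow_neg (hq : q ≠ 0) (m : ℕ) :
    ∏ j ∈ range m, q ^ (-((j : ℤ) + 1)) = q ^ (-(((m : ℤ) + 1) * (m + 1 - 1) / 2)) := by
  induction m with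
  | zero => simp
  | succ m ih =>
    rw [prod_range_succ, ih, ← zpow_add₀ hq]
    congr 1
    have h1 := two_mul_choose ((m : ℤ) + 1)
    have h2 := two_mul_choose (((m + 1 : ℕ) : ℤ) + 1)
    push_cast at *
    generalize ((m : ℤ) + 1) * (m + 1 - 1) / 2 = A at *
    generalize ((m : ℤ) + 1 + 1) * (m + 1 + 1 - 1) / 2 = B at *
    linarith

theorem det_connMatrix (hq : q ≠ 0) (n : ℕ) : (connMatrix q n d).det =
    (∏ i : Fin (d + 1), q ^ (-((((i : ℕ) : ℤ) + 1) * ((i : ℕ) + 1 - 1) / 2))) *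
      ∏ i ∈ range d, (1 - q ^ (n + i + 1)) ^ (i + 1) := by
  rw [Fin.prod_univ_eq_prod_range fun i : ℕ => q ^ (-(((i : ℤ) + 1) * (i + 1 - 1) / 2))]
  induction d with
  | zero => simp [connMatrix, connPoly]
  | succ d ih =>
    rw [det_connMatrix_succ hq, ih, prod_mul_distrib, prod_zpow_neg hq, prod_const, card_range,
      prod_range_succ (fun i : ℕ => q ^ (-(((i : ℤ) + 1) * (i + 1 - 1) / 2))) (d + 1),
      prod_range_succ (fun i : ℕ => (1 - q ^ (n + i + 1)) ^ (i + 1)) d]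
    ring

theorem det_coeff_mul_det_connMatrix (hq : q ≠ 0) (n : ℕ) (a : Fin (d + 1) → ℤ) :
    (Matrix.of fun i j : Fin (d + 1) => (qProd q n).coeff (a i - (j : ℕ))).det *
        (connMatrix q n d).det =
      (∏ i : Fin (d + 1), q ^ (-((i : ℕ) * a i)) * (qProd q (n + d)).coeff (a i)) *
        ∏ i : Fin (d + 1), ∏ j ∈ Ioi i, (1 - q ^ (a j - a i)) := by
  have hmul : (Matrix.of fun i j : Fin (d + 1) => (qProd q n).coeff (a i - (j : ℕ))) *
      connMatrix q n d = .of fun i j => (qProd q (n + d)).coeff (a i) *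
        Matrix.vandermonde (fun i => q ^ (-a i)) i j := by
    ext i j
    have hj : (j : ℕ) ≤ d := Nat.lt_succ_iff.mp j.isLt
    rw [Matrix.mul_apply, Matrix.of_apply, Matrix.vandermonde_apply, ← zpow_natCast, ← zpow_mul]
    simp only [Matrix.of_apply, connMatrix]
    rw [← coeff_mul_toLaurent _ _ (natDegree_connPoly_le hj), ← dilate_qProd_eq_mul_connPoly hq hj,
      coeff_dilate, ← zpow_mul, mul_comm]
    ring_nf
  have hswap : ∏ i : Fin (d + 1), ∏ j ∈ Ioi i, q ^ (-a j) = ∏ j : Fin (d + 1), q ^ (-((j : ℕ) * a j)) := by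
    rw [prod_comm' (t' := univ) (s' := fun j => Iio j) (by simp)]
    refine prod_congr rfl fun j _ => ?_
    rw [prod_const, Fin.card_Iio, ← zpow_natCast, ← zpow_mul]
    ring_nf
  have hdiff : ∀ i j, q ^ (-a j) - q ^ (-a i) = q ^ (-a j) * (1 - q ^ (a j - a i)) := fun i j => by
    rw [mul_sub, mul_one, ← zpow_add₀ hq]
    ring_nf
  rw [← Matrix.det_mul, hmul, Matrix.det_mul_column, Matrix.det_vandermonde]
  simp_rw [hdiff, prod_mul_distrib, hswap]
  ring

theorem prod_zpow_eq_zpow_sum {ι : Type*} (hq : q ≠ 0) (s : Finset ι) (f : ι → ℤ) :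
    ∏ i ∈ s, q ^ f i = q ^ ∑ i ∈ s, f i := by
  classical
  induction s using Finset.induction_on with
  | empty => simp
  | insert i s hi ih => rw [prod_insert hi, sum_insert hi, ih, zpow_add₀ hq]

theorem det_coeff_sliceMatrix_mul (hq : q ≠ 0) (hq1 : ∀ i : ℕ, 0 < i → q ^ i ≠ 1) (n : ℕ) (k : ℤ)
    (y : Fin (d + 1) → ℤ) (hy : ∑ i, y i = 0) :
    (Matrix.of fun i j => (sliceMatrix q d (T (-k) * qProd q n) i j).coeff (y i)).det *
        ∏ i ∈ range d, (1 - q ^ (n + i + 1)) ^ (i + 1) =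
      q ^ (((d : ℤ) + 1) * (k * (k - 1) / 2)) *
        ((∏ i : Fin (d + 1), ∏ j ∈ Ioi i,
            (1 - q ^ (((d : ℤ) + 1) * (y i - y j) + (j : ℕ) - (i : ℕ)))) *
          ∏ i : Fin (d + 1), (q ^ ((((d : ℤ) + 1) * (d + 1 + 1) / 2) * y i ^ 2 -
              (((i : ℕ) : ℤ) + 1) * y i) *
            qBinom q ((n : ℤ) + d) (k - (d + 1) * y i + (i : ℕ)))) := by
  set a : Fin (d + 1) → ℤ := fun i => k - (d + 1) * y i + (i : ℕ) with ha
  have hentry : (Matrix.of fun i j => (sliceMatrix q d (T (-k) * qProd q n) i j).coeff (y i)) =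
      .of fun i j => q ^ (((d : ℤ) + 1) * (y i * (y i - 1) / 2) - (i : ℕ) * y i) *
        (Matrix.of fun i j : Fin (d + 1) => (qProd q n).coeff (a i - (j : ℕ))) i j := by
    ext i j
    simp only [Matrix.of_apply, sliceMatrix, coeff_slice, coeff_T_mul, ha]
    ring_nf
  have hdiff : ∀ i j, ((d : ℤ) + 1) * (y i - y j) + (j : ℕ) - (i : ℕ) = a j - a i := fun i j => by
    simp only [ha]
    ring
  have hexp : ∀ i : Fin (d + 1), q ^ (((d : ℤ) + 1) * (y i * (y i - 1) / 2) - (i : ℕ) * y i) *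
      (q ^ (-((i : ℕ) * a i)) * q ^ (a i * (a i - 1) / 2)) =
      q ^ (-((((i : ℕ) : ℤ) + 1) * ((i : ℕ) + 1 - 1) / 2)) * (q ^ (k * (k - 1) / 2) *
        (q ^ ((1 - (d + 1) * k) * y i) *
          q ^ ((((d : ℤ) + 1) * (d + 1 + 1) / 2) * y i ^ 2 - (((i : ℕ) : ℤ) + 1) * y i))) := by
    intro i
    simp only [← zpow_add₀ hq]
    congr 1
    have h1 := two_mul_choose (y i)
    have h2 := two_mul_choose (a i)
    have h3 := two_mul_choose (((i : ℕ) : ℤ) + 1)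
    have h4 := two_mul_choose k
    have h5 : 2 * (((d : ℤ) + 1) * (d + 1 + 1) / 2) = (d + 1) * (d + 1 + 1) := by
      have := two_mul_choose ((d : ℤ) + 1 + 1)
      rwa [add_sub_cancel_right, mul_comm ((d : ℤ) + 1 + 1)] at this
    have h6 : a i = k - (d + 1) * y i + (i : ℕ) := rfl
    refine mul_left_cancel₀ two_ne_zero ?_
    rw [h6] at h2 ⊢
    linear_combination ((d : ℤ) + 1) * h1 + h2 + h3 - h4 - y i ^ 2 * h5
  have hlin : ∏ i, q ^ ((1 - (d + 1) * k) * y i) = 1 := by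
    simp_rw [zpow_mul]
    rw [prod_zpow_eq_zpow_sum (zpow_ne_zero _ hq), hy, zpow_zero]
  have hconst : ∏ _i : Fin (d + 1), q ^ (k * (k - 1) / 2) =
      q ^ (((d : ℤ) + 1) * (k * (k - 1) / 2)) := by
    rw [prod_const, card_univ, Fintype.card_fin, ← zpow_natCast, ← zpow_mul, mul_comm]
    push_cast
    rfl
  have hne : ∏ i : Fin (d + 1), q ^ (-((((i : ℕ) : ℤ) + 1) * ((i : ℕ) + 1 - 1) / 2)) ≠ 0 :=
    prod_ne_zero_iff.mpr fun i _ => zpow_ne_zero _ hq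
  have hdet := det_coeff_mul_det_connMatrix hq n a
  rw [det_connMatrix hq] at hdet
  simp only [coeff_qProd hq hq1 (n + d), Nat.cast_add n d] at hdet
  rw [hentry, Matrix.det_mul_column]
  simp_rw [hdiff]
  set w : Fin (d + 1) → ℂ := fun i => q ^ (((d : ℤ) + 1) * (y i * (y i - 1) / 2) - (i : ℕ) * y i)
  set P := ∏ i : Fin (d + 1), ∏ j ∈ Ioi i, (1 - q ^ (a j - a i))
  have hprod : (∏ i, w i) * ∏ i : Fin (d + 1), q ^ (-((i : ℕ) * a i)) *
        (q ^ (a i * (a i - 1) / 2) * qBinom q ((n : ℤ) + d) (a i)) =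
      (∏ i : Fin (d + 1), q ^ (-((((i : ℕ) : ℤ) + 1) * ((i : ℕ) + 1 - 1) / 2))) *
        ((∏ _i : Fin (d + 1), q ^ (k * (k - 1) / 2)) *
          ((∏ i, q ^ ((1 - (d + 1) * k) * y i)) *
            ∏ i : Fin (d + 1), (q ^ ((((d : ℤ) + 1) * (d + 1 + 1) / 2) * y i ^ 2 -
              (((i : ℕ) : ℤ) + 1) * y i) * qBinom q ((n : ℤ) + d) (a i)))) := by
    simp only [← prod_mul_distrib]
    refine prod_congr rfl fun i _ => ?_
    linear_combination qBinom q ((n : ℤ) + d) (a i) * hexp i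
  rw [hlin, one_mul, hconst] at hprod
  refine mul_left_cancel₀ hne ?_
  linear_combination (∏ i, w i) * hdet + P * hprod

/-- The `A_{r-1}` root-lattice q-binomial identity (appendix identity (A.4),
equation `Eq_tau-een`, of the paper), stated for all `q` that are neither `0`
nor a root of unity. -/
theorem Ar_root_lattice_identity (r : ℕ) (hr : 2 ≤ r) (n m : ℕ) (hm : m ≤ n)
    (q : ℂ) (hq0 : q ≠ 0) (hq1 : ∀ i : ℕ, 0 < i → q ^ i ≠ 1) :
    (∑' y : {y : Fin r → ℤ // ∑ i, y i = 0},
      (∏ p ∈ Finset.univ.filter (fun p : Fin r × Fin r => p.1 < p.2),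
          (1 - q ^ ((r : ℤ) * (y.1 p.1 - y.1 p.2) + ((p.2 : ℕ) : ℤ) - ((p.1 : ℕ) : ℤ)))) *
        ∏ i : Fin r,
          (q ^ (((r : ℤ) * ((r : ℤ) + 1) / 2) * y.1 i ^ 2 - (((i : ℕ) : ℤ) + 1) * y.1 i) *
            qBinom q ((n : ℤ) + r - 1) ((n : ℤ) - (m : ℤ) - r * y.1 i + ((i : ℕ) : ℤ))))
      = qBinom q n m * ∏ i ∈ Finset.range (r - 1), (1 - q ^ (n + i + 1)) ^ (i + 1) := by
  obtain ⟨d, rfl⟩ : ∃ d, r = d + 1 := ⟨r - 1, by omega⟩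
  set M := sliceMatrix q d (T (-((n - m : ℕ) : ℤ)) * qProd q n)
  set D := fun y : Fin (d + 1) → ℤ => (Matrix.of fun i j => (M i j).coeff (y i)).det with hD
  set Q := ∏ i ∈ range d, (1 - q ^ (n + i + 1)) ^ (i + 1)
  have hb := zpow_ne_zero (((d : ℤ) + 1) * (((n - m : ℕ) : ℤ) * ((n - m : ℕ) - 1) / 2)) hq0
  set b := q ^ (((d : ℤ) + 1) * (((n - m : ℕ) : ℤ) * ((n - m : ℕ) - 1) / 2))
  have hterm : ∀ y : {y : Fin (d + 1) → ℤ // ∑ i, y i = 0},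
      (∏ p ∈ univ.filter (fun p : Fin (d + 1) × Fin (d + 1) => p.1 < p.2),
          (1 - q ^ (((d + 1 : ℕ) : ℤ) * (y.1 p.1 - y.1 p.2) + ((p.2 : ℕ) : ℤ) -
            ((p.1 : ℕ) : ℤ)))) *
        ∏ i : Fin (d + 1),
          (q ^ ((((d + 1 : ℕ) : ℤ) * (((d + 1 : ℕ) : ℤ) + 1) / 2) * y.1 i ^ 2 -
              (((i : ℕ) : ℤ) + 1) * y.1 i) *
            qBinom q ((n : ℤ) + (d + 1 : ℕ) - 1)
              ((n : ℤ) - (m : ℤ) - (d + 1 : ℕ) * y.1 i + ((i : ℕ) : ℤ))) =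
      b⁻¹ * Q * D y.1 := by
    intro y
    have h := det_coeff_sliceMatrix_mul (d := d) hq0 hq1 n ((n - m : ℕ) : ℤ) y.1 y.2
    rw [prod_finset_product _ univ (fun i => Ioi i) (by simp)]
    have e : (n : ℤ) + (d + 1 : ℕ) - 1 = n + d := by push_cast; ring
    rw [mul_assoc, mul_comm Q, hD, h, inv_mul_cancel_left₀ hb, e]
    push_cast [hm]
    rfl
  set S := univ.biUnion fun i => univ.biUnion fun j => (M i j).coeff.support
  have hMS : ∀ i j, (M i j).coeff.support ⊆ S := fun i j y hy =>
    mem_biUnion.mpr ⟨i, mem_univ i, mem_biUnion.mpr ⟨j, mem_univ j, hy⟩⟩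
  have hsum : b * qBinom q n m =
      ∑ y ∈ Fintype.piFinset (fun _ => S) with ∑ i, y i = 0, D y := by
    rw [← qBinom_symm hm, ← Nat.cast_sub hm]
    exact (coeff_zero_det_sliceMatrix_qProd hq0 hq1 n _ (Nat.sub_le n m)).symm.trans
      (coeff_det_zero M S hMS)
  have hsupp : ∀ y : Fin (d + 1) → ℤ, y ∉ Fintype.piFinset (fun _ => S) → D y = 0 := by
    intro y hy
    obtain ⟨i, hi⟩ : ∃ i, y i ∉ S := by simpa using hy
    exact Matrix.det_eq_zero_of_row_eq_zero i fun j =>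
      Finsupp.notMem_support_iff.mp fun h => hi (hMS i j h)
  have htsum : ∑' y : {y : Fin (d + 1) → ℤ // ∑ i, y i = 0}, D y.1 =
      ∑ y ∈ Fintype.piFinset (fun _ => S) with ∑ i, y i = 0, D y := by
    have h := tsum_subtype {y : Fin (d + 1) → ℤ | ∑ i, y i = 0} D
    refine h.trans ?_
    rw [tsum_eq_sum (s := Fintype.piFinset fun _ => S), sum_filter]
    · simp only [Set.indicator_apply, Set.mem_ofPred_eq]
    · intro y hy
      rw [Set.indicator_apply, hsupp y hy, ite_self]
  rw [tsum_congr hterm, tsum_mul_left, htsum, ← hsum, Nat.add_sub_cancel]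
  field_simp
  exact mul_comm _ _

end Stmt18
end
end

section
/- Theorem (Nahm-type formula for the W₃(3,8) character χ̃_{2,2}^8; Tsuchioka's conjecture). As formal power series in q (equivalently for |q| < 1): (q^8;q^8)_∞² / (q;q)_∞² · θ(q³, q³, q⁶; q⁸) = Σ over nonnegative integers n_1,…,n_6 of q^{Q(n)} / [(q;q)_{n_1}(q;q)_{n_2}(q;q)_{n_3}(q;q)_{n_4}(q;q)_{n_5}(q;q)_{n_6}], where Q(n) := n_1²+n_2²+2n_3²+2n_4²+3n_5²+4n_6² + n_1n_2 + 2n_1n_3 + 2n_1n_4 + 2n_1n_5 + 2n_1n_6 + n_2n_3 + 2n_2n_4 + 2n_2n_5 + 3n_2n_6 + 3n_3n_4 + 4n_3n_5 + 4n_3n_6 + 4n_4n_5 + 5n_4n_6 + 6n_5n_6. -/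
noncomputable section

namespace Stmt19

/-- `(a; q)_n`, the finite q-Pochhammer symbol. -/
def qPoch (a q : ℂ) (n : ℕ) : ℂ := ∏ j ∈ Finset.range n, (1 - a * q ^ j)

/-- `(a; q)_∞`. -/
def qPochInf (a q : ℂ) : ℂ := ∏' j : ℕ, (1 - a * q ^ j)

/-- The modified theta function `θ(z; q) = (z;q)_∞ (q/z;q)_∞`. -/
def theta (z q : ℂ) : ℂ := qPochInf z q * qPochInf (q / z) q

section

open Filter Topology Finset

/-! ### Finite q-series identities -/

lemma one_sub_pow_ne_zero {q : ℂ} (hq : ‖q‖ < 1) (n : ℕ) : 1 - q ^ (n + 1) ≠ 0 := by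
  intro h
  have h1 : ‖q ^ (n + 1)‖ = 1 := by rw [← sub_eq_zero.mp h, norm_one]
  rw [norm_pow] at h1
  exact (pow_lt_one₀ (norm_nonneg q) hq n.succ_ne_zero).ne h1

lemma qPoch_self_zero (q : ℂ) : qPoch q q 0 = 1 := by simp [qPoch]

lemma qPoch_self_succ (q : ℂ) (n : ℕ) :
    qPoch q q (n + 1) = qPoch q q n * (1 - q ^ (n + 1)) := by
  rw [qPoch, qPoch, prod_range_succ, pow_succ']

lemma qPoch_self_ne_zero {q : ℂ} (hq : ‖q‖ < 1) (n : ℕ) : qPoch q q n ≠ 0 := by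
  induction n with
  | zero => simp [qPoch]
  | succ n ih => rw [qPoch_self_succ]; exact mul_ne_zero ih (one_sub_pow_ne_zero hq n)

lemma choose_two_succ (n : ℕ) : (n + 1).choose 2 = n + n.choose 2 := by
  rw [Nat.choose_succ_succ', Nat.choose_one_right]

/-- A finite form of Cauchy's identity `∑ q^{m(m+c)} / ((q)_m (q)_{m+c}) = 1 / (q)_∞`. -/
lemma sum_durfee {q : ℂ} (hq : ‖q‖ < 1) (M c : ℕ) :
    ∑ m ∈ range (M + 1), q ^ (m ^ 2 + c * m) /
      (qPoch q q (M - m) * qPoch q q m * qPoch q q (m + c)) =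
    1 / (qPoch q q M * qPoch q q (M + c)) := by
  induction M generalizing c with
  | zero => simp [qPoch_self_zero]
  | succ M ih =>
    have hP := qPoch_self_ne_zero hq
    have hM := one_sub_pow_ne_zero hq M
    refine mul_left_cancel₀ hM ?_
    have key : (1 - q ^ (M + 1)) * ∑ m ∈ range (M + 1 + 1), q ^ (m ^ 2 + c * m) /
        (qPoch q q (M + 1 - m) * qPoch q q m * qPoch q q (m + c)) =
        (∑ m ∈ range (M + 1), q ^ (m ^ 2 + c * m) /
          (qPoch q q (M - m) * qPoch q q m * qPoch q q (m + c))) +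
        q ^ (M + 1 + c) * ∑ m ∈ range (M + 1), q ^ (m ^ 2 + (c + 1) * m) /
          (qPoch q q (M - m) * qPoch q q m * qPoch q q (m + (c + 1))) := by
      have e1 : ∑ m ∈ range (M + 1), q ^ (m ^ 2 + c * m) /
          (qPoch q q (M - m) * qPoch q q m * qPoch q q (m + c)) =
          ∑ m ∈ range (M + 1 + 1), (1 - q ^ (M + 1 - m)) * (q ^ (m ^ 2 + c * m) /
          (qPoch q q (M + 1 - m) * qPoch q q m * qPoch q q (m + c))) := by
        rw [sum_range_succ _ (M + 1)]
        simp only [Nat.sub_self, pow_zero, sub_self, zero_mul, add_zero]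
        refine sum_congr rfl fun m hm => ?_
        obtain ⟨d, rfl⟩ := Nat.exists_eq_add_of_le (Nat.lt_succ_iff.mp (mem_range.mp hm))
        rw [show m + d + 1 - m = d + 1 by omega, show m + d - m = d by omega, qPoch_self_succ]
        have := one_sub_pow_ne_zero hq d
        have := hP d
        have := hP m
        have := hP (m + c)
        field_simp
      have e2 : q ^ (M + 1 + c) * ∑ m ∈ range (M + 1), q ^ (m ^ 2 + (c + 1) * m) /
          (qPoch q q (M - m) * qPoch q q m * qPoch q q (m + (c + 1))) =
          ∑ m ∈ range (M + 1 + 1), (q ^ (M + 1 - m) * (1 - q ^ m)) * (q ^ (m ^ 2 + c * m) /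
          (qPoch q q (M + 1 - m) * qPoch q q m * qPoch q q (m + c))) := by
        rw [sum_range_succ' _ (M + 1), mul_sum]
        simp only [pow_zero, sub_self, mul_zero, zero_mul, add_zero]
        refine sum_congr rfl fun m hm => ?_
        obtain ⟨d, rfl⟩ := Nat.exists_eq_add_of_le (Nat.lt_succ_iff.mp (mem_range.mp hm))
        rw [show m + d + 1 - (m + 1) = d by omega, show m + d - m = d by omega, qPoch_self_succ,
          show m + (c + 1) = m + 1 + c by ring]
        have := one_sub_pow_ne_zero hq m
        have := hP d
        have := hP m
        have := hP (m + 1 + c)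
        field_simp
        ring
      rw [e1, e2, ← sum_add_distrib, mul_sum]
      refine sum_congr rfl fun m hm => ?_
      have hp : q ^ (M + 1) = q ^ (M + 1 - m) * q ^ m := by
        rw [← pow_add]; congr 1; have := mem_range.mp hm; omega
      rw [hp]; ring
    rw [key, ih, ih, qPoch_self_succ, show M + (c + 1) = M + c + 1 by ring,
      show M + 1 + c = M + c + 1 by ring, qPoch_self_succ]
    have := one_sub_pow_ne_zero hq (M + c)
    have := hP M
    have := hP (M + c)
    field_simp
    ring

/-- The same identity, written as the merging of two summation variables. -/
lemma sum_merge {q : ℂ} (hq : ‖q‖ < 1) (a b : ℕ) :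
    ∑ k ∈ range (min a b + 1), q ^ ((a - k) * (b - k)) /
      (qPoch q q k * qPoch q q (a - k) * qPoch q q (b - k)) =
    1 / (qPoch q q a * qPoch q q b) := by
  wlog h : a ≤ b generalizing a b
  · have := this b a (by omega)
    rw [min_comm, mul_comm (qPoch q q a), ← this]
    exact sum_congr rfl fun k _ => by rw [mul_comm (b - k)]; congr 1; ring
  obtain ⟨c, rfl⟩ := Nat.exists_eq_add_of_le h
  rw [min_eq_left h, ← sum_durfee hq, ← sum_range_reflect]
  refine sum_congr rfl fun k hk => ?_
  obtain ⟨d, rfl⟩ := Nat.exists_eq_add_of_le (Nat.lt_succ_iff.mp (mem_range.mp hk))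
  rw [show k + d + 1 - 1 - k = d by omega, show k + d - d = k by omega,
    show k + d - k = d by omega, show k + d + c - d = k + c by omega]
  congr 1
  · congr 1; ring

/-- `(1 - y q^{2r}) (y)_r / ((1 - y) (q)_r)` for `y = q^b`. -/
def unitCoeff (q : ℂ) (b : ℕ) : ℕ → ℂ
  | 0 => 1
  | r + 1 => (1 - q ^ (b + 2 * r + 2)) * qPoch q q (b + r) / (qPoch q q b * qPoch q q (r + 1))

lemma sum_unitCoeff_partial {q : ℂ} (hq : ‖q‖ < 1) (b n R : ℕ) (hR : R ≤ n) :
    (1 - q ^ n) * ∑ r ∈ range (R + 1), (-1) ^ r * q ^ r.choose 2 * unitCoeff q b r /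
      (qPoch q q (n - r) * qPoch q q (n + r + b)) =
    (-1) ^ R * q ^ (R + 1).choose 2 * qPoch q q (b + R) * (1 - q ^ (n - R)) /
      (qPoch q q b * qPoch q q R * qPoch q q (n - R) * qPoch q q (n + R + b)) := by
  have hP := qPoch_self_ne_zero hq
  induction R with
  | zero =>
    have := hP b
    have := hP n
    have := hP (n + b)
    simp [unitCoeff, qPoch_self_zero]
    field_simp
  | succ R ih =>
    rw [sum_range_succ, mul_add, ih (by omega)]
    obtain ⟨d, rfl⟩ := Nat.exists_eq_add_of_le hR
    rw [show R + 1 + d - R = d + 1 by omega, show R + 1 + d - (R + 1) = d by omega, unitCoeff,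
      show R + 1 + d + (R + 1) + b = R + 1 + d + R + b + 1 by ring,
      show b + (R + 1) = b + R + 1 by ring]
    simp only [qPoch_self_succ, choose_two_succ]
    have := hP b
    have := hP d
    have := hP R
    have := hP (b + R)
    have := hP (R + 1 + d + R + b)
    have := one_sub_pow_ne_zero hq d
    have := one_sub_pow_ne_zero hq R
    have := one_sub_pow_ne_zero hq (R + 1 + d + R + b)
    field_simp
    ring

/-- The unit Bailey pair relative to `q^b`. -/
lemma sum_unitCoeff {q : ℂ} (hq : ‖q‖ < 1) (b n : ℕ) :
    ∑ r ∈ range (n + 1), (-1) ^ r * q ^ r.choose 2 * unitCoeff q b r /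
      (qPoch q q (n - r) * qPoch q q (n + r + b)) =
    if n = 0 then 1 / qPoch q q b else 0 := by
  rcases n with _ | n
  · simp [unitCoeff, qPoch_self_zero]
  · have h := sum_unitCoeff_partial hq b (n + 1) (n + 1) le_rfl
    rw [Nat.sub_self, pow_zero, sub_self, mul_zero, zero_div] at h
    rw [if_neg n.succ_ne_zero]
    exact (mul_eq_zero.mp h).resolve_left (one_sub_pow_ne_zero hq n)

/-- The iterated Bailey chain started from the unit pair relative to `q^b`. -/
def chain (q : ℂ) (b : ℕ) : ℕ → ℕ → ℂ
  | 0, n => if n = 0 then 1 else 0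
  | k + 1, n => ∑ N ∈ range (n + 1), q ^ (N ^ 2 + b * N) * chain q b k N / qPoch q q (n - N)

/-- Iterated Bailey lemma. -/
lemma chain_eq {q : ℂ} (hq : ‖q‖ < 1) (b k n : ℕ) :
    chain q b k n / qPoch q q b =
    ∑ r ∈ range (n + 1), (-1) ^ r * q ^ (k * (r ^ 2 + b * r) + r.choose 2) * unitCoeff q b r /
      (qPoch q q (n - r) * qPoch q q (n + r + b)) := by
  have hP := qPoch_self_ne_zero hq
  induction k generalizing n with
  | zero => simpa [chain, ite_div] using (sum_unitCoeff hq b n).symm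
  | succ k ih =>
    have h1 : chain q b (k + 1) n / qPoch q q b =
        ∑ N ∈ range (n + 1), ∑ r ∈ range (N + 1), q ^ (N ^ 2 + b * N) / qPoch q q (n - N) *
          ((-1) ^ r * q ^ (k * (r ^ 2 + b * r) + r.choose 2) * unitCoeff q b r /
          (qPoch q q (N - r) * qPoch q q (N + r + b))) := by
      rw [chain, sum_div]
      refine sum_congr rfl fun N _ => ?_
      rw [← mul_sum, ← ih N]
      ring
    have h2 : ∀ F : ℕ → ℕ → ℂ, ∑ N ∈ range (n + 1), ∑ r ∈ range (N + 1), F N r =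
        ∑ r ∈ range (n + 1), ∑ m ∈ range (n - r + 1), F (r + m) r := by
      intro F
      rw [sum_sigma', sum_sigma']
      refine sum_bij' (fun x _ => ⟨x.2, x.1 - x.2⟩) (fun x _ => ⟨x.1 + x.2, x.1⟩) ?_ ?_ ?_ ?_ ?_
      all_goals
        rintro ⟨x, y⟩ h
        simp only [mem_sigma, mem_range, Sigma.mk.injEq, heq_eq_eq, and_true] at *
      · omega
      · omega
      · omega
      · simp
      · rw [Nat.add_sub_of_le (by omega)]
    rw [h1, h2]
    refine sum_congr rfl fun r hr => ?_
    obtain ⟨M, rfl⟩ := Nat.exists_eq_add_of_le (Nat.lt_succ_iff.mp (mem_range.mp hr))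
    rw [show r + M - r = M by omega]
    have h3 := sum_durfee hq M (2 * r + b)
    have h4 : r + M + r + b = M + (2 * r + b) := by ring
    have h5 : ∀ x : ℂ, x / (qPoch q q M * qPoch q q (r + M + r + b)) =
        x * (1 / (qPoch q q M * qPoch q q (M + (2 * r + b)))) := by
      intro x; rw [h4]; ring
    rw [h5, ← h3, mul_sum]
    refine sum_congr rfl fun m hm => ?_
    rw [show r + M - (r + m) = M - m by omega, show r + m - r = m by omega,
      show r + m + r + b = m + (2 * r + b) by ring]
    have := hP (M - m)
    have := hP m
    have := hP (m + (2 * r + b))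
    field_simp
    ring

lemma sum_cross_partial {q : ℂ} (hq : ‖q‖ < 1) (w t R : ℕ) (hw : R ≤ w) (ht : R ≤ t)
    (h : R + 1 ≤ w + t) :
    (1 - q ^ w) * (1 - q ^ t) * ∑ r ∈ range (R + 1), (-1) ^ r * q ^ r.choose 2 *
      qPoch q q (w + t - r - 1) / (qPoch q q (w - r) * qPoch q q (t - r) * qPoch q q r) =
    (-1) ^ R * q ^ (R + 1).choose 2 * qPoch q q (w + t - R - 1) * (1 - q ^ (w - R)) *
      (1 - q ^ (t - R)) / (qPoch q q (w - R) * qPoch q q (t - R) * qPoch q q R) := by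
  have hP := qPoch_self_ne_zero hq
  induction R with
  | zero => simp [qPoch_self_zero]; ring
  | succ R ih =>
    rw [sum_range_succ, mul_add, ih (by omega) (by omega) (by omega)]
    obtain ⟨d, rfl⟩ := Nat.exists_eq_add_of_le hw
    obtain ⟨e, rfl⟩ := Nat.exists_eq_add_of_le ht
    rw [show R + 1 + d - R = d + 1 by omega, show R + 1 + d - (R + 1) = d by omega,
      show R + 1 + e - R = e + 1 by omega, show R + 1 + e - (R + 1) = e by omega,
      show R + 1 + d + (R + 1 + e) - R - 1 = R + d + e + 1 by omega,
      show R + 1 + d + (R + 1 + e) - (R + 1) - 1 = R + d + e by omega]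
    simp only [qPoch_self_succ, choose_two_succ]
    have := hP d
    have := hP e
    have := hP R
    have := one_sub_pow_ne_zero hq d
    have := one_sub_pow_ne_zero hq e
    have := one_sub_pow_ne_zero hq R
    field_simp
    ring

/-- A vanishing alternating sum. -/
lemma sum_cross {q : ℂ} (hq : ‖q‖ < 1) (w t : ℕ) :
    ∑ r ∈ range (min w t + 1), (-1) ^ r * q ^ r.choose 2 * unitCoeff q (w + t - 2 * r) r *
      qPoch q q (w + t - 2 * r) / (qPoch q q (w - r) * qPoch q q (t - r)) =
    if w = 0 ∨ t = 0 then 1 else 0 := by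
  have hP := qPoch_self_ne_zero hq
  rcases w with _ | w
  · simp [unitCoeff, qPoch_self_zero, hP]
  rcases t with _ | t
  · simp [unitCoeff, qPoch_self_zero, hP]
  have h := sum_cross_partial hq (w + 1) (t + 1) (min (w + 1) (t + 1)) (min_le_left _ _)
    (min_le_right _ _) (by omega)
  have h0 : (1 - q ^ (w + 1 - min (w + 1) (t + 1))) *
      (1 - q ^ (t + 1 - min (w + 1) (t + 1))) = 0 := by
    rcases le_total w t with h | h <;> simp [h]
  rw [mul_assoc _ (1 - q ^ (w + 1 - min (w + 1) (t + 1))), h0, mul_zero, zero_div] at h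
  have h1 := (mul_eq_zero.mp h).resolve_left
    (mul_ne_zero (one_sub_pow_ne_zero hq w) (one_sub_pow_ne_zero hq t))
  rw [if_neg (by omega), ← mul_zero (1 - q ^ (w + t + 1 + 1)), ← h1, mul_sum]
  refine sum_congr rfl fun r hr => ?_
  have hr := mem_range.mp hr
  have := hP (w + 1 - r)
  have := hP (t + 1 - r)
  rcases r with _ | r
  · rw [unitCoeff, show w + 1 + (t + 1) - 2 * 0 = w + t + 1 + 1 by omega,
      show w + t + 1 + 1 - 1 = w + t + 1 by omega, qPoch_self_succ q (w + t + 1),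
      qPoch_self_zero]
    field_simp
  · rw [unitCoeff, show w + 1 + (t + 1) - 2 * (r + 1) + 2 * r + 2 = w + t + 1 + 1 by omega,
      show w + 1 + (t + 1) - 2 * (r + 1) + r = w + 1 + (t + 1) - (r + 1) - 1 by omega]
    have := hP (w + 1 + (t + 1) - 2 * (r + 1))
    have := hP (r + 1)
    field_simp

/-- The finite q-binomial theorem. -/
lemma prod_one_add_mul_pow {q : ℂ} (hq : ‖q‖ < 1) (x : ℂ) (n : ℕ) :
    ∏ k ∈ range n, (1 + x * q ^ k) =
    ∑ j ∈ range (n + 1), qPoch q q n * (q ^ j.choose 2 * x ^ j / qPoch q q j) /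
      qPoch q q (n - j) := by
  have hP := qPoch_self_ne_zero hq
  induction n generalizing x with
  | zero => simp [qPoch_self_zero]
  | succ n ih =>
    have e0 : ∏ k ∈ range (n + 1), (1 + x * q ^ k) =
        (1 + x) * ∏ k ∈ range n, (1 + (x * q) * q ^ k) := by
      rw [prod_range_succ', pow_zero, mul_one, mul_comm]
      congr 1
      exact prod_congr rfl fun k _ => by ring
    rw [e0, ih, add_mul, one_mul]
    have e1 : ∑ j ∈ range (n + 1), qPoch q q n * (q ^ j.choose 2 * (x * q) ^ j / qPoch q q j) /
        qPoch q q (n - j) = ∑ j ∈ range (n + 1 + 1), qPoch q q n * q ^ j *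
          (1 - q ^ (n + 1 - j)) * (q ^ j.choose 2 * x ^ j / qPoch q q j) /
          qPoch q q (n + 1 - j) := by
      rw [sum_range_succ _ (n + 1)]
      simp only [Nat.sub_self, pow_zero, sub_self, mul_zero, zero_mul, zero_div, add_zero]
      refine sum_congr rfl fun j hj => ?_
      obtain ⟨d, rfl⟩ := Nat.exists_eq_add_of_le (Nat.lt_succ_iff.mp (mem_range.mp hj))
      rw [show j + d + 1 - j = d + 1 by omega, show j + d - j = d by omega, qPoch_self_succ q d]
      have := one_sub_pow_ne_zero hq d
      have := hP d
      have := hP j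
      rw [mul_pow]
      field_simp
    have e2 : x * ∑ j ∈ range (n + 1), qPoch q q n *
        (q ^ j.choose 2 * (x * q) ^ j / qPoch q q j) /
        qPoch q q (n - j) = ∑ j ∈ range (n + 1 + 1), qPoch q q n *
          (1 - q ^ j) * (q ^ j.choose 2 * x ^ j / qPoch q q j) /
          qPoch q q (n + 1 - j) := by
      rw [sum_range_succ' _ (n + 1), mul_sum]
      simp only [pow_zero, sub_self, mul_zero, zero_mul, zero_div, add_zero]
      refine sum_congr rfl fun j hj => ?_
      obtain ⟨d, rfl⟩ := Nat.exists_eq_add_of_le (Nat.lt_succ_iff.mp (mem_range.mp hj))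
      rw [show j + d + 1 - (j + 1) = d by omega, show j + d - j = d by omega,
        qPoch_self_succ q j, choose_two_succ]
      have := one_sub_pow_ne_zero hq j
      have := hP d
      have := hP j
      field_simp
      ring
    rw [e2, e1, ← sum_add_distrib]
    refine sum_congr rfl fun j hj => ?_
    have hp : q ^ (n + 1) = q ^ (n + 1 - j) * q ^ j := by
      rw [← pow_add]; congr 1; have := mem_range.mp hj; omega
    rw [qPoch_self_succ q n, hp]
    ring

/-! ### Infinite products and limits -/

lemma summable_mul_pow {q : ℂ} (hq : ‖q‖ < 1) (x : ℂ) : Summable fun k : ℕ => ‖x * q ^ k‖ := by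
  simpa [norm_mul, norm_pow] using
    (summable_geometric_of_lt_one (norm_nonneg q) hq).mul_left ‖x‖

lemma multipliable_one_sub_mul_pow {q : ℂ} (hq : ‖q‖ < 1) (x : ℂ) :
    Multipliable fun k : ℕ => 1 - x * q ^ k := by
  simpa [sub_eq_add_neg] using
    multipliable_one_add_of_summable (f := fun k : ℕ => -(x * q ^ k))
      (by simpa using summable_mul_pow hq x)

lemma tendsto_qPoch {q : ℂ} (hq : ‖q‖ < 1) (x : ℂ) :
    Tendsto (qPoch x q) atTop (𝓝 (qPochInf x q)) :=
  (multipliable_one_sub_mul_pow hq x).tendsto_prod_tprod_nat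

lemma qPochInf_self_ne_zero {q : ℂ} (hq : ‖q‖ < 1) : qPochInf q q ≠ 0 := by
  have h := tprod_one_add_ne_zero_of_summable (f := fun k : ℕ => -(q * q ^ k))
    (fun k => by
      rw [← sub_eq_add_neg, ← pow_succ']
      exact one_sub_pow_ne_zero hq k)
    (by simpa using summable_mul_pow hq q)
  simpa [qPochInf, sub_eq_add_neg] using h

lemma exists_bound {q : ℂ} (hq : ‖q‖ < 1) :
    ∃ K : ℝ, 0 < K ∧ ∀ n, ‖qPoch q q n‖ ≤ K ∧ ‖(qPoch q q n)⁻¹‖ ≤ K := by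
  have h1 := tendsto_qPoch hq q
  have h2 := h1.inv₀ (qPochInf_self_ne_zero hq)
  obtain ⟨K1, -, hK1⟩ := (Metric.isBounded_range_of_tendsto _ h1).exists_pos_norm_le
  obtain ⟨K2, hp, hK2⟩ := (Metric.isBounded_range_of_tendsto _ h2).exists_pos_norm_le
  exact ⟨max K1 K2, lt_max_of_lt_right hp, fun n =>
    ⟨(hK1 _ ⟨n, rfl⟩).trans (le_max_left _ _), (hK2 _ ⟨n, rfl⟩).trans (le_max_right _ _)⟩⟩

/-- Multiplying a summable sequence by the partial sums of a convergent kernel. -/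
lemma tendsto_sum_div_qPoch {q : ℂ} (hq : ‖q‖ < 1) {F : ℕ → ℂ} (hF : Summable F) :
    Tendsto (fun M => ∑ m ∈ range (M + 1), F m / qPoch q q (M - m)) atTop
      (𝓝 ((∑' m, F m) / qPochInf q q)) := by
  obtain ⟨K, hK, hb⟩ := exists_bound hq
  have h := tendsto_tsum_of_dominated_convergence (𝓕 := atTop)
    (f := fun M m => if m ∈ range (M + 1) then F m / qPoch q q (M - m) else 0)
    (g := fun m => F m / qPochInf q q) (bound := fun m => ‖F m‖ * K) (hF.norm.mul_right K)
    (fun m => by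
      refine Tendsto.congr' ?_ (tendsto_const_nhds.div
        ((tendsto_qPoch hq q).comp (tendsto_sub_atTop_nat m)) (qPochInf_self_ne_zero hq))
      filter_upwards [eventually_ge_atTop m] with M hM
      rw [if_pos (mem_range.mpr (by omega))]
      rfl)
    (Eventually.of_forall fun M m => by
      split_ifs
      · rw [div_eq_mul_inv, norm_mul]
        exact mul_le_mul_of_nonneg_left (hb _).2 (norm_nonneg _)
      · rw [norm_zero]; positivity)
  rw [tsum_div_const] at h
  refine h.congr fun M => ?_
  rw [tsum_eq_sum (s := range (M + 1)) (fun m hm => if_neg hm)]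
  exact sum_congr rfl fun m hm => if_pos hm

lemma summable_pow_of_le {r : ℝ} (h0 : 0 ≤ r) (h1 : r < 1) {e : ℕ → ℕ} (he : ∀ n, n ≤ e n) :
    Summable fun n => r ^ e n :=
  Summable.of_nonneg_of_le (fun _ => pow_nonneg h0 _)
    (fun n => pow_le_pow_of_le_one h0 h1.le (he n)) (summable_geometric_of_lt_one h0 h1)

lemma summable_durfee {q : ℂ} (hq : ‖q‖ < 1) (c d : ℕ) :
    Summable fun m : ℕ => q ^ (m ^ 2 + d * m) / (qPoch q q m * qPoch q q (m + c)) := by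
  obtain ⟨K, hK, hb⟩ := exists_bound hq
  refine Summable.of_norm_bounded (g := fun m : ℕ => ‖q‖ ^ (m ^ 2 + d * m) * (K * K))
    ((summable_pow_of_le (norm_nonneg q) hq fun n => by nlinarith).mul_right _) fun m => ?_
  rw [div_eq_mul_inv, mul_inv, norm_mul, norm_mul, norm_pow]
  gcongr
  exacts [(hb _).2, (hb _).2]

lemma tsum_durfee {q : ℂ} (hq : ‖q‖ < 1) (c : ℕ) :
    ∑' m : ℕ, q ^ (m ^ 2 + c * m) / (qPoch q q m * qPoch q q (m + c)) = 1 / qPochInf q q := by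
  have hne := qPochInf_self_ne_zero hq
  have h1 := tendsto_sum_div_qPoch hq (summable_durfee hq c c)
  have h2 : Tendsto (fun M => 1 / (qPoch q q M * qPoch q q (M + c))) atTop
      (𝓝 (1 / (qPochInf q q * qPochInf q q))) :=
    tendsto_const_nhds.div
      ((tendsto_qPoch hq q).mul ((tendsto_qPoch hq q).comp (tendsto_add_atTop_nat c)))
      (mul_ne_zero hne hne)
  have h3 := tendsto_nhds_unique h1 (h2.congr fun M => by
    rw [← sum_durfee hq M c]
    refine sum_congr rfl fun m _ => ?_
    rw [div_div]
    congr 1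
    ring)
  rw [div_eq_iff hne] at h3
  rw [h3]
  field_simp

lemma summable_euler {q : ℂ} (hq : ‖q‖ < 1) (x : ℂ) :
    Summable fun n : ℕ => q ^ n.choose 2 * x ^ n / qPoch q q n := by
  obtain ⟨K, hK, hb⟩ := exists_bound hq
  have h : Summable fun n : ℕ => q ^ n.choose 2 * x ^ n := by
    refine summable_of_ratio_norm_eventually_le (r := 1 / 2) (by norm_num) ?_
    have h1 : Tendsto (fun n : ℕ => ‖q‖ ^ n * ‖x‖) atTop (𝓝 (0 * ‖x‖)) :=
      (tendsto_pow_atTop_nhds_zero_of_lt_one (norm_nonneg q) hq).mul_const _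
    rw [zero_mul] at h1
    filter_upwards [h1.eventually (eventually_le_nhds (b := 1 / 2) (by norm_num))] with n hn
    rw [choose_two_succ, show q ^ (n + n.choose 2) * x ^ (n + 1) =
      q ^ n * x * (q ^ n.choose 2 * x ^ n) by ring, norm_mul, norm_mul, norm_pow]
    exact mul_le_mul_of_nonneg_right hn (norm_nonneg _)
  refine Summable.of_norm_bounded (h.norm.mul_right K) fun n => ?_
  rw [div_eq_mul_inv, norm_mul]
  exact mul_le_mul_of_nonneg_left (hb n).2 (norm_nonneg _)

/-- Euler's identity. -/
lemma tsum_euler {q : ℂ} (hq : ‖q‖ < 1) (x : ℂ) :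
    ∑' n : ℕ, q ^ n.choose 2 * x ^ n / qPoch q q n = qPochInf (-x) q := by
  have hne := qPochInf_self_ne_zero hq
  have h1 := (tendsto_qPoch hq q).mul (tendsto_sum_div_qPoch hq (summable_euler hq x))
  rw [mul_div_cancel₀ _ hne] at h1
  refine tendsto_nhds_unique (h1.congr fun M => ?_) (tendsto_qPoch hq (-x))
  have h2 := prod_one_add_mul_pow hq x M
  simp only [qPoch, neg_mul, sub_neg_eq_add] at h2 ⊢
  rw [h2, mul_sum]
  exact sum_congr rfl fun j _ => by ring

/-- `∑_m q^{m² + dm} / ((q)_m (q)_{m+d+b})` as a finite sum. -/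
lemma tsum_durfee_shift {q : ℂ} (hq : ‖q‖ < 1) (b d : ℕ) :
    ∑' m : ℕ, q ^ (m ^ 2 + d * m) / (qPoch q q m * qPoch q q (m + (d + b))) =
    1 / qPochInf q q * ∑ j ∈ range (b + 1), qPoch q q b * q ^ (j ^ 2 + j * d) /
      (qPoch q q j * qPoch q q (b - j)) := by
  have hP := qPoch_self_ne_zero hq
  induction b generalizing d with
  | zero => simpa [qPoch_self_zero] using tsum_durfee hq d
  | succ b ih =>
    have h1 : ∀ m : ℕ, q ^ (m ^ 2 + d * m) / (qPoch q q m * qPoch q q (m + (d + (b + 1)))) =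
        q ^ (m ^ 2 + (d + 1) * m) / (qPoch q q m * qPoch q q (m + (d + 1 + b))) +
        (1 - q ^ m) * q ^ (m ^ 2 + d * m) / (qPoch q q m * qPoch q q (m + (d + 1 + b))) := by
      intro m
      rw [show d + (b + 1) = d + 1 + b by ring]
      ring
    have hs1 := summable_durfee hq (d + 1 + b) (d + 1)
    have hs2 : Summable fun m : ℕ =>
        (1 - q ^ m) * q ^ (m ^ 2 + d * m) / (qPoch q q m * qPoch q q (m + (d + 1 + b))) := by
      refine ((summable_durfee hq (d + 1 + b) d).sub hs1).congr fun m => ?_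
      ring
    have h2 : ∀ m : ℕ, (1 - q ^ (m + 1)) * q ^ ((m + 1) ^ 2 + d * (m + 1)) /
        (qPoch q q (m + 1) * qPoch q q (m + 1 + (d + 1 + b))) =
        q ^ (1 + d) * (q ^ (m ^ 2 + (d + 2) * m) /
          (qPoch q q m * qPoch q q (m + (d + 2 + b)))) := by
      intro m
      rw [qPoch_self_succ q m, show m + 1 + (d + 1 + b) = m + (d + 2 + b) by ring]
      have := one_sub_pow_ne_zero hq m
      have := hP m
      have := hP (m + (d + 2 + b))
      field_simp
      ring
    simp_rw [h1]
    rw [hs1.tsum_add hs2, hs2.tsum_eq_zero_add]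
    simp_rw [h2]
    rw [tsum_mul_left, ih, ih]
    simp only [pow_zero, sub_self, zero_mul, zero_div, zero_add]
    rw [mul_left_comm, ← mul_add]
    congr 1
    have h3 : ∀ j ∈ range (b + 2), qPoch q q (b + 1) * q ^ (j ^ 2 + j * d) /
        (qPoch q q j * qPoch q q (b + 1 - j)) =
        (1 - q ^ j) * (qPoch q q b * q ^ (j ^ 2 + j * d) /
          (qPoch q q j * qPoch q q (b + 1 - j))) +
        q ^ j * (1 - q ^ (b + 1 - j)) * (qPoch q q b * q ^ (j ^ 2 + j * d) /
          (qPoch q q j * qPoch q q (b + 1 - j))) := by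
      intro j hj
      have h4 : q ^ j * q ^ (b + 1 - j) = q ^ (b + 1) := by
        rw [← pow_add, Nat.add_sub_of_le (by simpa [Nat.lt_succ_iff] using hj)]
      rw [qPoch_self_succ, ← h4]
      ring
    rw [sum_congr rfl h3, sum_add_distrib, add_comm, mul_sum,
      sum_range_succ' (fun j => (1 - q ^ j) * (qPoch q q b * q ^ (j ^ 2 + j * d) /
        (qPoch q q j * qPoch q q (b + 1 - j)))),
      sum_range_succ (fun j => q ^ j * (1 - q ^ (b + 1 - j)) * (qPoch q q b *
        q ^ (j ^ 2 + j * d) / (qPoch q q j * qPoch q q (b + 1 - j))))]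
    simp only [pow_zero, Nat.sub_self, sub_self, zero_mul, mul_zero, add_zero]
    congr 1
    · refine sum_congr rfl fun j hj => ?_
      rw [show b + 1 - (j + 1) = b - j by omega, qPoch_self_succ q j]
      have := one_sub_pow_ne_zero hq j
      have := hP j
      have := hP (b - j)
      field_simp
      ring
    · refine sum_congr rfl fun j hj => ?_
      rw [show b + 1 - j = b - j + 1 by have := mem_range.mp hj; omega, qPoch_self_succ q (b - j)]
      have := one_sub_pow_ne_zero hq (b - j)
      have := hP j
      have := hP (b - j)
      field_simp
      ring

/-! ### Regrouping of multiple series -/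

/-- Regroup a summable family along an injection whose fibres over `β` are finite. -/
lemma tsum_fiberwise {α β γ : Type*} {f : α → ℂ} (hf : Summable f) (φ : α → β × γ)
    (hφ : Function.Injective φ) (S : β → Finset γ) (F : β → γ → ℂ)
    (hS : ∀ b c, c ∈ S b ↔ (b, c) ∈ Set.range φ) (hF : ∀ a, F (φ a).1 (φ a).2 = f a) :
    Summable (fun b => ∑ c ∈ S b, F b c) ∧ ∑' a, f a = ∑' b, ∑ c ∈ S b, F b c := by
  classical
  let G : β × γ → ℂ := fun x => if x.2 ∈ S x.1 then F x.1 x.2 else 0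
  have hG : G ∘ φ = f := by
    funext a
    have : (φ a).2 ∈ S (φ a).1 := (hS _ _).2 ⟨a, rfl⟩
    simp only [G, Function.comp_apply, if_pos this, hF]
  have hsupp : ∀ x ∉ Set.range φ, G x = 0 := fun x hx => if_neg fun h => hx ((hS _ _).1 h)
  have hGs : Summable G := (hφ.summable_iff hsupp).1 (hG ▸ hf)
  have hin : ∀ b, ∑' c, G (b, c) = ∑ c ∈ S b, F b c := fun b => by
    rw [tsum_eq_sum (s := S b) fun c hc => if_neg hc]
    exact sum_congr rfl fun c hc => if_pos hc
  simp_rw [← hin]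
  refine ⟨hGs.prod, ?_⟩
  rw [← hGs.tsum_prod, ← hG]
  exact hφ.tsum_eq (Function.support_subset_iff'.2 hsupp)

lemma tsum_conv {ι : Type*} (f : ι → ℕ → ℕ → ℂ) (g : ι → ℕ → ℂ)
    (hf : Summable fun x : (ι × ℕ) × ℕ => f x.1.1 x.1.2 x.2)
    (h : ∀ i n, ∑ r ∈ range (n + 1), f i (n - r) r = g i n) :
    Summable (fun x : ι × ℕ => g x.1 x.2) ∧
    ∑' x : (ι × ℕ) × ℕ, f x.1.1 x.1.2 x.2 = ∑' x : ι × ℕ, g x.1 x.2 := by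
  simp_rw [← h]
  refine tsum_fiberwise hf (fun x => ((x.1.1, x.1.2 + x.2), x.2)) ?_
    (fun x => range (x.2 + 1)) (fun x r => f x.1 (x.2 - r) r) ?_ ?_
  · rintro ⟨⟨i, a⟩, r⟩ ⟨⟨i', a'⟩, r'⟩ h
    simp only [Prod.mk.injEq] at h ⊢
    refine ⟨⟨h.1.1, ?_⟩, h.2⟩
    have := h.1.2
    have := h.2
    omega
  · rintro ⟨i, n⟩ r
    simp only [mem_range, Set.mem_range, Prod.mk.injEq, Prod.exists]
    refine ⟨fun h => ⟨i, n - r, r, ⟨rfl, by omega⟩, rfl⟩, ?_⟩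
    rintro ⟨_, a, _, ⟨_, rfl⟩, rfl⟩
    omega
  · rintro ⟨⟨i, a⟩, r⟩
    simp

lemma summable_pow_add {r : ℝ} (hr : 0 ≤ r) {ι κ : Type*} {f : ι → ℕ} {g : κ → ℕ}
    (hf : Summable fun i => r ^ f i) (hg : Summable fun k => r ^ g k) :
    Summable fun x : ι × κ => r ^ (f x.1 + g x.2) := by
  simp_rw [pow_add]
  exact hf.mul_of_nonneg hg (fun _ => pow_nonneg hr _) fun _ => pow_nonneg hr _

lemma summable_pow_add₃ {r : ℝ} (hr : 0 ≤ r) (h1 : r < 1) :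
    Summable fun x : (ℕ × ℕ) × ℕ => r ^ (x.1.1 + x.1.2 + x.2) := by
  have h := summable_geometric_of_lt_one hr h1
  exact summable_pow_add hr (f := fun x : ℕ × ℕ => x.1 + x.2) (g := fun n => n)
    (summable_pow_add hr (f := fun n => n) (g := fun n => n) h h) h

lemma summable_of_norm_le_pow {q : ℂ} (hq : ‖q‖ < 1) {ι : Type*} {f : ι → ℂ} {d e : ι → ℕ}
    (hd : Summable fun i => ‖q‖ ^ d i) (hde : ∀ i, d i ≤ e i) {C : ℝ} (hC : 0 ≤ C)
    (h : ∀ i, ‖f i‖ ≤ ‖q‖ ^ e i * C) : Summable f := by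
  refine Summable.of_norm_bounded (hd.mul_right C) fun i => (h i).trans ?_
  exact mul_le_mul_of_nonneg_right (pow_le_pow_of_le_one (norm_nonneg q) hq.le (hde i)) hC

lemma exists_bound_unitCoeff {q : ℂ} (hq : ‖q‖ < 1) :
    ∃ C : ℝ, 0 < C ∧ ∀ b r, ‖unitCoeff q b r‖ ≤ C := by
  obtain ⟨K, hK, hb⟩ := exists_bound hq
  refine ⟨1 + 2 * K * (K * K), by positivity, fun b r => ?_⟩
  rcases r with _ | r
  · simp only [unitCoeff, norm_one]
    linarith [show 0 < 2 * K * (K * K) by positivity]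
  · rw [unitCoeff, div_eq_mul_inv, mul_inv, norm_mul, norm_mul, norm_mul]
    have h1 : ‖1 - q ^ (b + 2 * r + 2)‖ ≤ 2 := by
      refine (norm_sub_le _ _).trans ?_
      rw [norm_one, norm_pow]
      linarith [pow_le_one₀ (n := b + 2 * r + 2) (norm_nonneg q) hq.le]
    have h2 := (hb (b + r)).1
    have h3 := (hb b).2
    have h4 := (hb (r + 1)).2
    calc _ ≤ 2 * K * (K * K) := by gcongr
      _ ≤ _ := by linarith

lemma chain_one (q : ℂ) (b n : ℕ) : chain q b 1 n = 1 / qPoch q q n := by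
  rw [chain, sum_eq_single 0]
  · simp [chain]
  · intro N _ hN
    simp [chain, hN]
  · simp

lemma summable_nahm {q : ℂ} (hq : ‖q‖ < 1) {e : (Fin 6 → ℕ) → ℕ}
    (he : ∀ n, n 0 + n 1 + n 2 + n 3 + n 4 + n 5 ≤ e n) :
    Summable fun n : Fin 6 → ℕ => q ^ e n /
      (qPoch q q (n 0) * qPoch q q (n 1) * qPoch q q (n 2) * qPoch q q (n 3) *
        qPoch q q (n 4) * qPoch q q (n 5)) := by
  obtain ⟨K, hK, hb⟩ := exists_bound hq
  have hg := summable_geometric_of_lt_one (norm_nonneg q) hq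
  have h0 := norm_nonneg q
  have hs := summable_pow_add h0 (summable_pow_add h0 (summable_pow_add h0 (summable_pow_add h0
    (summable_pow_add h0 hg hg) hg) hg) hg) hg
  have hi : Function.Injective fun n : Fin 6 → ℕ => (((((n 0, n 1), n 2), n 3), n 4), n 5) := by
    intro n m h
    simp only [Prod.mk.injEq] at h
    funext i
    fin_cases i <;> simp [h]
  refine summable_of_norm_le_pow hq (hs.comp_injective hi) he
    (C := K * K * K * K * K * K) (by positivity) fun n => ?_
  rw [div_eq_mul_inv, norm_mul, norm_pow]
  refine mul_le_mul_of_nonneg_left ?_ (by positivity)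
  simp only [mul_inv, norm_mul]
  gcongr
  exacts [(hb _).2, (hb _).2, (hb _).2, (hb _).2, (hb _).2, (hb _).2]

/-! ### Evaluation of the sum -/

/-- The quadratic form in the exponent of the sixfold series. -/
def nahmForm (n : Fin 6 → ℕ) : ℕ :=
  n 0 ^ 2 + n 1 ^ 2 + 2 * n 2 ^ 2 + 2 * n 3 ^ 2 + 3 * n 4 ^ 2 + 4 * n 5 ^ 2 +
    n 0 * n 1 + 2 * n 0 * n 2 + 2 * n 0 * n 3 + 2 * n 0 * n 4 + 2 * n 0 * n 5 +
    n 1 * n 2 + 2 * n 1 * n 3 + 2 * n 1 * n 4 + 3 * n 1 * n 5 +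
    3 * n 2 * n 3 + 4 * n 2 * n 4 + 4 * n 2 * n 5 +
    4 * n 3 * n 4 + 5 * n 3 * n 5 + 6 * n 4 * n 5

/-- The summand of the sixfold series. -/
def nahmTerm (q : ℂ) (n : Fin 6 → ℕ) : ℂ :=
  q ^ nahmForm n / (qPoch q q (n 0) * qPoch q q (n 1) * qPoch q q (n 2) * qPoch q q (n 3) *
    qPoch q q (n 4) * qPoch q q (n 5))

lemma le_nahmForm (n : Fin 6 → ℕ) : n 0 + n 1 + n 2 + n 3 + n 4 + n 5 ≤ nahmForm n := by
  have h := fun i : Fin 6 => Nat.le_self_pow two_ne_zero (n i)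
  have := h 0
  have := h 1
  have := h 2
  have := h 3
  have := h 4
  have := h 5
  unfold nahmForm
  omega

lemma summable_nahmTerm {q : ℂ} (hq : ‖q‖ < 1) : Summable (nahmTerm q) :=
  summable_nahm hq le_nahmForm

/-- The summand after merging `n₁ + n₄` and `n₂ + n₄`. -/
def mergedTerm (q : ℂ) (b a c d e : ℕ) : ℂ :=
  q ^ ((a + (c + (d + e))) ^ 2 + (c + (d + e)) ^ 2 + (d + e) ^ 2 + e ^ 2 + b ^ 2 +
      b * (c + (d + e)) + b * (d + e) + b * e) /
    (qPoch q q b * qPoch q q a * qPoch q q c * qPoch q q d * qPoch q q e)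

lemma tsum_nahmTerm {q : ℂ} (hq : ‖q‖ < 1) :
    Summable (fun x : (((ℕ × ℕ) × ℕ) × ℕ) × ℕ =>
      mergedTerm q x.1.1.1.1 x.1.1.1.2 x.1.1.2 x.1.2 x.2) ∧
    ∑' n, nahmTerm q n = ∑' x : (((ℕ × ℕ) × ℕ) × ℕ) × ℕ,
      mergedTerm q x.1.1.1.1 x.1.1.1.2 x.1.1.2 x.1.2 x.2 := by
  have key : ∀ b a c d e : ℕ, mergedTerm q b a c d e =
      ∑ k ∈ range (min a b + 1), nahmTerm q ![a - k, b - k, c, k, d, e] := by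
    intro b a c d e
    have h1 : mergedTerm q b a c d e = q ^ ((a + (c + (d + e))) ^ 2 + (c + (d + e)) ^ 2 +
        (d + e) ^ 2 + e ^ 2 + b ^ 2 + b * (c + (d + e)) + b * (d + e) + b * e) /
        (qPoch q q c * qPoch q q d * qPoch q q e) * (1 / (qPoch q q a * qPoch q q b)) := by
      rw [mergedTerm, div_mul_div_comm, mul_one]
      congr 1
      ring
    rw [h1, ← sum_merge hq a b, mul_sum]
    refine sum_congr rfl fun k hk => ?_
    obtain ⟨x, rfl⟩ : ∃ x, a = x + k := ⟨a - k, by have := mem_range.1 hk; omega⟩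
    obtain ⟨y, rfl⟩ : ∃ y, b = y + k := ⟨b - k, by have := mem_range.1 hk; omega⟩
    rw [div_mul_div_comm, ← pow_add, nahmTerm, nahmForm]
    simp only [Nat.add_sub_cancel, Matrix.cons_val]
    congr 1
    · congr 1
      ring
    · ring
  simp_rw [key]
  refine tsum_fiberwise (summable_nahmTerm hq)
    (fun n => (((((n 1 + n 3, n 0 + n 3), n 2), n 4), n 5), n 3)) ?_
    (fun x => range (min x.1.1.1.2 x.1.1.1.1 + 1))
    (fun x k => nahmTerm q ![x.1.1.1.2 - k, x.1.1.1.1 - k, x.1.1.2, k, x.1.2, x.2]) ?_ ?_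
  · intro n m h
    simp only [Prod.mk.injEq] at h
    obtain ⟨⟨⟨⟨⟨h1, h2⟩, h3⟩, h4⟩, h5⟩, h6⟩ := h
    funext i
    fin_cases i <;> simp <;> omega
  · rintro ⟨⟨⟨⟨b, a⟩, c⟩, d⟩, e⟩ k
    simp only [mem_range, Set.mem_range, Prod.mk.injEq]
    constructor
    · intro h
      refine ⟨![a - k, b - k, c, k, d, e], ?_⟩
      simp
      omega
    · rintro ⟨n, h⟩
      omega
  · intro n
    congr 1
    funext i
    fin_cases i <;> simp

lemma tsum_mergedTerm {q : ℂ} (hq : ‖q‖ < 1) :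
    ∑' n, nahmTerm q n = ∑' x : ℕ × ℕ,
      q ^ (x.2 ^ 2 + x.1 ^ 2) * (chain q x.1 4 x.2 / qPoch q q x.1) := by
  obtain ⟨h1, h2⟩ := tsum_nahmTerm hq
  obtain ⟨h3, h4⟩ := tsum_conv
    (fun (i : ((ℕ × ℕ) × ℕ)) d e => mergedTerm q i.1.1 i.1.2 i.2 d e)
    (fun i n => q ^ ((i.1.2 + (i.2 + n)) ^ 2 + (i.2 + n) ^ 2 + n ^ 2 + i.1.1 ^ 2 +
      i.1.1 * (i.2 + n) + i.1.1 * n) * chain q i.1.1 2 n /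
      (qPoch q q i.1.1 * qPoch q q i.1.2 * qPoch q q i.2)) h1 (by
    intro i n
    rw [chain, mul_sum, sum_div]
    refine sum_congr rfl fun r hr => ?_
    have hr := mem_range.1 hr
    rw [mergedTerm, chain_one, show n - r + r = n by omega]
    ring)
  obtain ⟨h5, h6⟩ := tsum_conv
    (fun (i : ℕ × ℕ) c n => q ^ ((i.2 + (c + n)) ^ 2 + (c + n) ^ 2 + n ^ 2 + i.1 ^ 2 +
      i.1 * (c + n) + i.1 * n) * chain q i.1 2 n /
      (qPoch q q i.1 * qPoch q q i.2 * qPoch q q c))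
    (fun i n => q ^ ((i.2 + n) ^ 2 + n ^ 2 + i.1 ^ 2 + i.1 * n) * chain q i.1 3 n /
      (qPoch q q i.1 * qPoch q q i.2)) h3 (by
    intro i n
    rw [chain, mul_sum, sum_div]
    refine sum_congr rfl fun r hr => ?_
    have hr := mem_range.1 hr
    rw [show n - r + r = n by omega]
    ring)
  obtain ⟨h7, h8⟩ := tsum_conv
    (fun (b : ℕ) a n => q ^ ((a + n) ^ 2 + n ^ 2 + b ^ 2 + b * n) * chain q b 3 n /
      (qPoch q q b * qPoch q q a))
    (fun b n => q ^ (n ^ 2 + b ^ 2) * (chain q b 4 n / qPoch q q b)) h5 (by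
    intro b n
    rw [chain, mul_div_assoc', mul_sum, sum_div]
    refine sum_congr rfl fun r hr => ?_
    have hr := mem_range.1 hr
    rw [show n - r + r = n by omega]
    ring)
  exact h2.trans (h4.trans (h6.trans h8))

/-- The summand after expanding the chain by the iterated Bailey lemma. -/
def baileyTerm (q : ℂ) (b r m : ℕ) : ℂ :=
  (-1) ^ r * q ^ (m ^ 2 + 2 * r * m + (5 * r ^ 2 + b ^ 2 + 4 * (b * r) + r.choose 2)) *
    unitCoeff q b r / (qPoch q q m * qPoch q q (m + (2 * r + b)))

/-- The summand after evaluating the innermost sum. -/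
def crossTerm (q : ℂ) (b r j : ℕ) : ℂ :=
  (-1) ^ r * q ^ (j ^ 2 + 2 * r * j + (5 * r ^ 2 + b ^ 2 + 4 * (b * r) + r.choose 2)) *
    unitCoeff q b r * qPoch q q b / (qPoch q q j * qPoch q q (b - j))

lemma summable_baileyTerm {q : ℂ} (hq : ‖q‖ < 1) :
    Summable fun x : (ℕ × ℕ) × ℕ => baileyTerm q x.1.1 x.1.2 x.2 := by
  obtain ⟨K, hK, hb⟩ := exists_bound hq
  obtain ⟨C, hC, hA⟩ := exists_bound_unitCoeff hq
  refine summable_of_norm_le_pow hq (summable_pow_add₃ (norm_nonneg q) hq)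
    (e := fun x => x.2 ^ 2 + 2 * x.1.2 * x.2 +
      (5 * x.1.2 ^ 2 + x.1.1 ^ 2 + 4 * (x.1.1 * x.1.2) + x.1.2.choose 2))
    (C := C * (K * K)) ?_ (by positivity) ?_
  · rintro ⟨⟨b, r⟩, m⟩
    have := Nat.le_self_pow two_ne_zero b
    have := Nat.le_self_pow two_ne_zero r
    have := Nat.le_self_pow two_ne_zero m
    dsimp only
    omega
  · rintro ⟨⟨b, r⟩, m⟩
    simp only [baileyTerm, div_eq_mul_inv, mul_inv, norm_mul, norm_pow, norm_neg, norm_one,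
      one_pow, one_mul]
    rw [mul_assoc]
    gcongr
    exacts [hA _ _, (hb _).2, (hb _).2]

lemma summable_crossTerm {q : ℂ} (hq : ‖q‖ < 1) :
    Summable fun x : (ℕ × ℕ) × ℕ => crossTerm q (x.1.2 + x.2) x.1.1 x.1.2 := by
  obtain ⟨K, hK, hb⟩ := exists_bound hq
  obtain ⟨C, hC, hA⟩ := exists_bound_unitCoeff hq
  refine summable_of_norm_le_pow hq (summable_pow_add₃ (norm_nonneg q) hq)
    (e := fun x => x.1.2 ^ 2 + 2 * x.1.1 * x.1.2 +
      (5 * x.1.1 ^ 2 + (x.1.2 + x.2) ^ 2 + 4 * ((x.1.2 + x.2) * x.1.1) + x.1.1.choose 2))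
    (C := C * K * (K * K)) ?_ (by positivity) ?_
  · rintro ⟨⟨r, j⟩, k⟩
    have := Nat.le_self_pow two_ne_zero r
    have := Nat.le_self_pow two_ne_zero (j + k)
    dsimp only
    generalize (j + k) ^ 2 = u at *
    generalize (j + k) * r = v
    omega
  · rintro ⟨⟨r, j⟩, k⟩
    simp only [crossTerm, div_eq_mul_inv, mul_inv, norm_mul, norm_pow, norm_neg, norm_one,
      one_pow, one_mul, Nat.add_sub_cancel_left]
    rw [mul_assoc, mul_assoc, ← mul_assoc ‖unitCoeff _ _ _‖]
    gcongr
    exacts [hA _ _, (hb _).1, (hb _).2, (hb _).2]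

lemma tsum_baileyTerm {q : ℂ} (hq : ‖q‖ < 1) :
    ∑' n, nahmTerm q n = ∑' x : (ℕ × ℕ) × ℕ, baileyTerm q x.1.1 x.1.2 x.2 := by
  rw [tsum_mergedTerm hq]
  symm
  rw [(tsum_fiberwise (summable_baileyTerm hq) (fun x => ((x.1.1, x.2 + x.1.2), x.1.2)) ?_
    (fun x => range (x.2 + 1)) (fun x r => baileyTerm q x.1 r (x.2 - r)) ?_ ?_).2]
  · refine tsum_congr fun ⟨b, n⟩ => ?_
    dsimp only
    rw [chain_eq hq, mul_sum]
    refine sum_congr rfl fun r hr => ?_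
    obtain ⟨m, rfl⟩ : ∃ m, n = m + r := ⟨n - r, by have := mem_range.1 hr; omega⟩
    rw [baileyTerm, Nat.add_sub_cancel, show m + r + r + b = m + (2 * r + b) by ring]
    ring
  · rintro ⟨⟨b, r⟩, m⟩ ⟨⟨b', r'⟩, m'⟩ h
    simp only [Prod.mk.injEq] at h ⊢
    omega
  · rintro ⟨b, n⟩ r
    simp only [mem_range, Set.mem_range, Prod.mk.injEq, Prod.exists]
    refine ⟨fun h => ⟨b, r, n - r, ⟨rfl, by omega⟩, rfl⟩, ?_⟩
    rintro ⟨b', r', m', h⟩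
    omega
  · rintro ⟨⟨b, r⟩, m⟩
    simp

lemma tsum_baileyTerm_inner {q : ℂ} (hq : ‖q‖ < 1) (b r : ℕ) :
    ∑' m, baileyTerm q b r m =
    1 / qPochInf q q * ∑ j ∈ range (b + 1), crossTerm q b r j := by
  have h : ∀ m, baileyTerm q b r m =
      (-1) ^ r * q ^ (5 * r ^ 2 + b ^ 2 + 4 * (b * r) + r.choose 2) *
      unitCoeff q b r * (q ^ (m ^ 2 + (2 * r) * m) /
        (qPoch q q m * qPoch q q (m + (2 * r + b)))) := fun m => by
    rw [baileyTerm]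
    ring
  simp_rw [h]
  rw [tsum_mul_left, tsum_durfee_shift hq, mul_left_comm, mul_sum]
  congr 1
  refine sum_congr rfl fun j _ => ?_
  rw [crossTerm]
  ring

lemma tsum_crossTerm {q : ℂ} (hq : ‖q‖ < 1) :
    ∑' x : ℕ × ℕ, ∑ j ∈ range (x.1 + 1), crossTerm q x.1 x.2 j =
    ∑' x : ℕ × ℕ, q ^ ((x.1 + x.2) ^ 2 + x.1 ^ 2) * if x.1 = 0 ∨ x.2 = 0 then 1 else 0 := by
  have hG := summable_crossTerm hq
  rw [← (tsum_fiberwise hG (fun x => ((x.1.2 + x.2, x.1.1), x.1.2)) ?_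
      (fun x => range (x.1 + 1)) (fun x j => crossTerm q x.1 x.2 j) ?_ fun _ => rfl).2,
    (tsum_fiberwise hG (fun x => ((x.1.2 + x.1.1, x.2 + x.1.1), x.1.1)) ?_
      (fun x => range (min x.1 x.2 + 1))
      (fun x r => crossTerm q (x.1 - r + (x.2 - r)) r (x.1 - r)) ?_ ?_).2]
  · refine tsum_congr fun ⟨w, t⟩ => ?_
    dsimp only
    rw [← sum_cross hq w t, mul_sum]
    refine sum_congr rfl fun r hr => ?_
    obtain ⟨j, rfl⟩ : ∃ j, w = j + r := ⟨w - r, by have := mem_range.1 hr; omega⟩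
    obtain ⟨k, rfl⟩ : ∃ k, t = k + r := ⟨t - r, by have := mem_range.1 hr; omega⟩
    rw [crossTerm, Nat.add_sub_cancel, Nat.add_sub_cancel, Nat.add_sub_cancel_left,
      show j + r + (k + r) - 2 * r = j + k by omega]
    ring
  · rintro ⟨⟨r, j⟩, k⟩ ⟨⟨r', j'⟩, k'⟩ h
    simp only [Prod.mk.injEq] at h ⊢
    omega
  · rintro ⟨w, t⟩ r
    simp only [mem_range, Set.mem_range, Prod.mk.injEq, Prod.exists]
    refine ⟨fun h => ⟨r, w - r, t - r, ⟨by omega, by omega⟩, rfl⟩, ?_⟩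
    rintro ⟨r', j', k', h⟩
    omega
  · rintro ⟨⟨r, j⟩, k⟩
    simp
  · rintro ⟨⟨r, j⟩, k⟩ ⟨⟨r', j'⟩, k'⟩ h
    simp only [Prod.mk.injEq] at h ⊢
    omega
  · rintro ⟨b, r⟩ j
    simp only [mem_range, Set.mem_range, Prod.mk.injEq, Prod.exists]
    refine ⟨fun h => ⟨r, j, b - j, ⟨by omega, rfl⟩, rfl⟩, ?_⟩
    rintro ⟨r', j', k', h⟩
    omega

lemma qPochInf_mul_tsum_nahmTerm {q : ℂ} (hq : ‖q‖ < 1) :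
    qPochInf q q * ∑' n, nahmTerm q n = ∑' x : ℕ × ℕ,
      q ^ ((x.1 + x.2) ^ 2 + x.1 ^ 2) * if x.1 = 0 ∨ x.2 = 0 then 1 else 0 := by
  rw [tsum_baileyTerm hq, (summable_baileyTerm hq).tsum_prod]
  simp only [tsum_baileyTerm_inner hq]
  rw [tsum_mul_left, ← mul_assoc, mul_one_div_cancel (qPochInf_self_ne_zero hq), one_mul,
    tsum_crossTerm hq]

lemma tsum_axes {q : ℂ} (hq : ‖q‖ < 1) :
    ∑' x : ℕ × ℕ, (q ^ ((x.1 + x.2) ^ 2 + x.1 ^ 2) * if x.1 = 0 ∨ x.2 = 0 then 1 else 0) =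
    ∑' n : ℕ, q ^ n ^ 2 + ∑' n : ℕ, q ^ (2 * (n + 1) ^ 2) := by
  have hg := summable_geometric_of_lt_one (norm_nonneg q) hq
  have hs : Summable fun x : ℕ × ℕ =>
      q ^ ((x.1 + x.2) ^ 2 + x.1 ^ 2) * if x.1 = 0 ∨ x.2 = 0 then (1 : ℂ) else 0 := by
    refine summable_of_norm_le_pow hq (summable_pow_add (norm_nonneg q) (f := fun n => n)
      (g := fun n => n) hg hg) (e := fun x => (x.1 + x.2) ^ 2 + x.1 ^ 2) (fun x => ?_)
      zero_le_one fun x => ?_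
    · have := Nat.le_self_pow two_ne_zero (x.1 + x.2)
      omega
    · rw [norm_mul, norm_pow]
      refine mul_le_mul_of_nonneg_left ?_ (by positivity)
      split_ifs <;> simp
  rw [hs.tsum_prod, hs.prod.tsum_eq_zero_add]
  congr 1
  · simp
  · refine tsum_congr fun n => ?_
    rw [tsum_eq_single 0]
    · simp [two_mul]
    · intro t ht
      simp [ht]

/-! ### The Jacobi triple product -/

lemma norm_pow_lt_one {q : ℂ} (hq : ‖q‖ < 1) {n : ℕ} (hn : n ≠ 0) : ‖q ^ n‖ < 1 := by
  rw [norm_pow]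
  exact pow_lt_one₀ (norm_nonneg q) hq hn

lemma pow_choose_two_mul_pow (p z : ℂ) (n : ℕ) :
    (p ^ 2) ^ n.choose 2 * (z * p) ^ n = p ^ n ^ 2 * z ^ n := by
  have h : 2 * n.choose 2 + n = n ^ 2 := by
    induction n with
    | zero => rfl
    | succ n ih => rw [choose_two_succ]; linarith
  rw [← h, mul_pow]
  ring

/-- Pairs of naturals, indexed by their difference and their minimum. -/
def diffMinEquiv : ℤ × ℕ ≃ ℕ × ℕ where
  toFun x := (x.2 + x.1.toNat, x.2 + (-x.1).toNat)
  invFun y := ((y.1 : ℤ) - y.2, min y.1 y.2)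
  left_inv x := by
    ext
    · dsimp only; omega
    · dsimp only; omega
  right_inv y := by
    ext
    · dsimp only; omega
    · dsimp only; omega

lemma euler_mul_euler_diffMin {p z : ℂ} (hp : ‖p‖ < 1) (hz : z ≠ 0) (c : ℤ) (m : ℕ) :
    (p ^ 2) ^ (m + c.toNat).choose 2 * (z * p) ^ (m + c.toNat) /
        qPoch (p ^ 2) (p ^ 2) (m + c.toNat) *
      ((p ^ 2) ^ (m + (-c).toNat).choose 2 * (z⁻¹ * p) ^ (m + (-c).toNat) /
        qPoch (p ^ 2) (p ^ 2) (m + (-c).toNat)) =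
    (p ^ 2) ^ (m ^ 2 + c.natAbs * m) /
      (qPoch (p ^ 2) (p ^ 2) m * qPoch (p ^ 2) (p ^ 2) (m + c.natAbs)) * (p ^ (c ^ 2) * z ^ c) := by
  have hP := qPoch_self_ne_zero (norm_pow_lt_one hp two_ne_zero)
  rw [pow_choose_two_mul_pow, pow_choose_two_mul_pow]
  obtain ⟨k, rfl | rfl⟩ := Int.eq_nat_or_neg c
  · rw [Int.toNat_natCast, Int.toNat_neg_natCast, Int.natAbs_natCast, zpow_natCast,
      ← Nat.cast_pow, zpow_natCast, add_zero, inv_pow]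
    have := hP m
    have := hP (m + k)
    field_simp
    ring
  · rw [neg_neg, Int.toNat_natCast, Int.toNat_neg_natCast, Int.natAbs_neg, Int.natAbs_natCast,
      zpow_neg, neg_sq, zpow_natCast, ← Nat.cast_pow, zpow_natCast, add_zero, inv_pow]
    have := hP m
    have := hP (m + k)
    field_simp
    ring

lemma hasSum_euler_mul {q : ℂ} (hq : ‖q‖ < 1) (x y : ℂ) :
    HasSum (fun i : ℕ × ℕ => q ^ i.1.choose 2 * x ^ i.1 / qPoch q q i.1 *
      (q ^ i.2.choose 2 * y ^ i.2 / qPoch q q i.2)) (qPochInf (-x) q * qPochInf (-y) q) := by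
  have hx := summable_euler hq x
  have hy := summable_euler hq y
  have h := (summable_mul_of_summable_norm hx.norm hy.norm).hasSum
  rwa [← tsum_mul_tsum_of_summable_norm hx.norm hy.norm, tsum_euler hq, tsum_euler hq] at h

/-- The Jacobi triple product identity. -/
lemma hasSum_jacobi {p z : ℂ} (hp : ‖p‖ < 1) (hz : z ≠ 0) :
    HasSum (fun n : ℤ => p ^ (n ^ 2) * z ^ n)
      (qPochInf (-(z * p)) (p ^ 2) * qPochInf (-(z⁻¹ * p)) (p ^ 2) *
        qPochInf (p ^ 2) (p ^ 2)) := by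
  have hQ := norm_pow_lt_one hp two_ne_zero
  have hne := qPochInf_self_ne_zero hQ
  have h3 := diffMinEquiv.hasSum_iff.2 (hasSum_euler_mul hQ (z * p) (z⁻¹ * p))
  have h4 : ∀ c : ℤ, HasSum (fun m : ℕ => (p ^ 2) ^ (m ^ 2 + c.natAbs * m) /
      (qPoch (p ^ 2) (p ^ 2) m * qPoch (p ^ 2) (p ^ 2) (m + c.natAbs)) * (p ^ (c ^ 2) * z ^ c))
      (1 / qPochInf (p ^ 2) (p ^ 2) * (p ^ (c ^ 2) * z ^ c)) := fun c => by
    rw [← tsum_durfee hQ c.natAbs]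
    exact (summable_durfee hQ c.natAbs c.natAbs).hasSum.mul_right _
  simp_rw [← euler_mul_euler_diffMin hp hz] at h4
  have h5 := (h3.prod_fiberwise h4).mul_left (qPochInf (p ^ 2) (p ^ 2))
  simp only [← mul_assoc, mul_one_div_cancel hne, one_mul] at h5
  rwa [mul_comm, ← mul_assoc]

/-! ### Evaluation of the product -/

lemma qPochInf_dissect {q : ℂ} (hq : ‖q‖ < 1) (x : ℂ) :
    qPochInf x q = qPochInf x (q ^ 2) * qPochInf (x * q) (q ^ 2) := by
  have hQ := norm_pow_lt_one hq two_ne_zero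
  have h := tprod_even_mul_odd (f := fun k => 1 - x * q ^ k)
    (by simpa only [pow_mul] using multipliable_one_sub_mul_pow hQ x)
    (by
      refine (multipliable_one_sub_mul_pow hQ (x * q)).congr fun k => ?_
      ring)
  rw [qPochInf, ← h, qPochInf, qPochInf]
  congr 1
  · exact tprod_congr fun k => by rw [pow_mul]
  · exact tprod_congr fun k => by ring

lemma qPochInf_mul_neg {q : ℂ} (hq : ‖q‖ < 1) (x : ℂ) :
    qPochInf x q * qPochInf (-x) q = qPochInf (x ^ 2) (q ^ 2) := by
  rw [qPochInf, qPochInf, ← (multipliable_one_sub_mul_pow hq x).tprod_mul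
    (multipliable_one_sub_mul_pow hq (-x))]
  exact tprod_congr fun k => by ring

lemma hasSum_mul_prod {ι κ : Type*} {f : ι → ℂ} {g : κ → ℂ} {a b : ℂ} (hf : HasSum f a)
    (hg : HasSum g b) : HasSum (fun x : ι × κ => f x.1 * g x.2) (a * b) := by
  have h := (summable_mul_of_summable_norm hf.summable.norm hg.summable.norm).hasSum
  rwa [← tsum_mul_tsum_of_summable_norm hf.summable.norm hg.summable.norm, hf.tsum_eq,
    hg.tsum_eq] at h

/-- Squaring `∑ (-1)^n q^{4n² + n}` by passing to the sum and the difference of the indices. -/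
lemma sq_eq_of_hasSum {q f a b a' b' : ℂ} (h0 : q ≠ 0)
    (hf : HasSum (fun n : ℤ => (q ^ 4) ^ (n ^ 2) * (-q) ^ n) f)
    (ha : HasSum (fun n : ℤ => (q ^ 2) ^ (n ^ 2) * (-q) ^ n) a)
    (hb : HasSum (fun n : ℤ => (q ^ 2) ^ (n ^ 2) * 1 ^ n) b)
    (ha' : HasSum (fun n : ℤ => (q ^ 2) ^ (n ^ 2) * q ^ n) a')
    (hb' : HasSum (fun n : ℤ => (q ^ 2) ^ (n ^ 2) * (-1) ^ n) b') :
    f * f = (a * b + a' * b') / 2 := by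
  have h1 := ((hasSum_mul_prod ha hb).add (hasSum_mul_prod ha' hb')).div_const 2
  have hinj : Function.Injective fun x : ℤ × ℤ => (x.1 + x.2, x.1 - x.2) := by
    rintro ⟨m, n⟩ ⟨m', n'⟩ h
    simp only [Prod.mk.injEq] at h ⊢
    omega
  rw [← hinj.hasSum_iff] at h1
  · refine (hasSum_mul_prod hf hf).unique (h1.congr_fun fun x => ?_)
    obtain ⟨m, n⟩ := x
    have h2 : (q ^ 2) ^ ((m + n) ^ 2) * (q ^ 2) ^ ((m - n) ^ 2) =
        (q ^ 4) ^ (m ^ 2) * (q ^ 4) ^ (n ^ 2) := by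
      rw [← zpow_add₀ (pow_ne_zero 2 h0), ← zpow_add₀ (pow_ne_zero 4 h0), ← zpow_natCast,
        ← zpow_natCast, ← zpow_mul, ← zpow_mul]
      congr 1
      push_cast
      ring
    have h3 : (-1 : ℂ) ^ (m - n) = (-1) ^ m * (-1) ^ n := by
      rw [zpow_sub₀ (neg_ne_zero.2 one_ne_zero), div_eq_mul_inv, ← inv_zpow, inv_neg, inv_one]
    simp only [Function.comp_apply]
    rw [neg_eq_neg_one_mul q, mul_zpow, mul_zpow, mul_zpow, h3, one_zpow, zpow_add₀ h0,
      zpow_add₀ (neg_ne_zero.2 one_ne_zero)]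
    linear_combination (-((-1) ^ m * (-1) ^ n * q ^ m * q ^ n)) * h2
  · rintro ⟨s, t⟩ h
    have hodd : Odd (s + t) := by
      rw [← Int.not_even_iff_odd]
      rintro ⟨k, hk⟩
      exact h ⟨(k, s - k), by simp only [Prod.mk.injEq]; omega⟩
    have h2 : (-1 : ℂ) ^ s + (-1) ^ t = 0 := by
      rcases Int.even_or_odd s with hs | hs
      · rw [hs.neg_one_zpow, ((Int.odd_add'.1 hodd).2 hs).neg_one_zpow]
        ring
      · rw [hs.neg_one_zpow, ((Int.odd_add.1 hodd).1 hs).neg_one_zpow]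
        ring
    rw [neg_eq_neg_one_mul, mul_zpow, one_zpow]
    linear_combination (q ^ 2) ^ (s ^ 2) * q ^ s * (q ^ 2) ^ (t ^ 2) / 2 * h2

lemma tsum_int_sq {q : ℂ} (hs : Summable fun n : ℤ => q ^ (n ^ 2) * 1 ^ n) :
    ∑' n : ℤ, q ^ (n ^ 2) * 1 ^ n = 1 + 2 * ∑' n : ℕ, q ^ ((n + 1) ^ 2) := by
  have h1 : Summable fun n : ℕ => q ^ (n ^ 2) := by
    refine (hs.comp_injective Nat.cast_injective).congr fun n => ?_
    simp only [Function.comp_apply, one_zpow, mul_one]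
    rw [← Nat.cast_pow, zpow_natCast]
  have h2 := (summable_nat_add_iff 1).2 h1
  have h3 : ∀ n : ℕ, q ^ ((n : ℤ) ^ 2) * 1 ^ (n : ℤ) = q ^ (n ^ 2) := fun n => by
    rw [one_zpow, mul_one, ← Nat.cast_pow, zpow_natCast]
  have h4 : ∀ n : ℕ, q ^ ((-((n : ℤ) + 1)) ^ 2) * 1 ^ (-((n : ℤ) + 1)) = q ^ ((n + 1) ^ 2) :=
    fun n => by
      rw [one_zpow, mul_one, neg_sq, ← Nat.cast_succ, ← Nat.cast_pow, zpow_natCast]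
  rw [tsum_of_nat_of_neg_add_one (by simpa only [h3]) (by simpa only [h4])]
  simp only [h3, h4]
  rw [h1.tsum_eq_zero_add]
  ring

lemma qPochInf_mul_theta {q : ℂ} (hq : ‖q‖ < 1) (h0 : q ≠ 0) :
    qPochInf (q ^ 8) (q ^ 8) ^ 2 *
      (theta (q ^ 3) (q ^ 8) * theta (q ^ 3) (q ^ 8) * theta (q ^ 6) (q ^ 8)) =
    qPochInf q q * (∑' n : ℕ, q ^ n ^ 2 + ∑' n : ℕ, q ^ (2 * (n + 1) ^ 2)) := by
  have hn1 : -q ≠ 0 := neg_ne_zero.2 h0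
  have hq2 := norm_pow_lt_one hq two_ne_zero
  have hq4 := norm_pow_lt_one hq four_ne_zero
  have hF := hasSum_jacobi hq4 hn1
  have hA := hasSum_jacobi hq2 hn1
  have hB := hasSum_jacobi hq2 one_ne_zero
  have hA' := hasSum_jacobi hq2 h0
  have hB' := hasSum_jacobi hq2 (neg_ne_zero.2 one_ne_zero)
  have hφ := hasSum_jacobi hq one_ne_zero
  have hsq := sq_eq_of_hasSum h0 hF hA hB hA' hB'
  have hφ1 := hφ.tsum_eq
  have hφ2 := hB.tsum_eq
  rw [tsum_int_sq hφ.summable] at hφ1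
  rw [tsum_int_sq hB.summable] at hφ2
  have hz : ∑' n : ℕ, q ^ n ^ 2 = 1 + ∑' n : ℕ, q ^ ((n + 1) ^ 2) := by
    have hs : Summable fun n : ℕ => q ^ n ^ 2 := Summable.of_norm <| by
      simpa only [norm_pow] using
        summable_pow_of_le (norm_nonneg q) hq fun n => Nat.le_self_pow two_ne_zero n
    rw [hs.tsum_eq_zero_add]
    simp
  have e1 : q * q ^ 4 = q ^ 5 := by ring
  have e2 : q⁻¹ * q ^ 4 = q ^ 3 := by field_simp
  have e3 : q * q ^ 2 = q ^ 3 := by ring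
  have e4 : q⁻¹ * q ^ 2 = q := by field_simp
  have e5 : q ^ 8 / q ^ 3 = q ^ 5 := by field_simp
  have e6 : q ^ 8 / q ^ 6 = q ^ 2 := by field_simp
  have e7 : q ^ 2 * q ^ 4 = q ^ 6 := by ring
  have e8 : q * q = q ^ 2 := by ring
  have d1 := qPochInf_dissect hq4 (q ^ 2)
  have d2 := qPochInf_dissect hq2 q
  have d3 := qPochInf_dissect hq2 (-q)
  have d4 := qPochInf_dissect hq q
  have d5 := qPochInf_dissect hq2 (q ^ 2)
  have d6 := qPochInf_mul_neg hq2 q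
  simp only [e1, e2, e3, e4, e7, e8, ← pow_mul, ← pow_add, inv_one, one_mul, inv_neg, neg_mul,
    neg_neg, Nat.reduceMul, Nat.reduceAdd] at hsq hφ1 hφ2 d1 d2 d3 d4 d5 d6
  rw [d2, d3] at d6
  have ha : ∑' n : ℕ, q ^ (n + 1) ^ 2 =
      (qPochInf (-q) (q ^ 2) * qPochInf (-q) (q ^ 2) * qPochInf (q ^ 2) (q ^ 2) - 1) / 2 := by
    rw [← hφ1]
    ring
  have hc : ∑' n : ℕ, q ^ (2 * (n + 1) ^ 2) =
      (qPochInf (-q ^ 2) (q ^ 4) * qPochInf (-q ^ 2) (q ^ 4) * qPochInf (q ^ 4) (q ^ 4) - 1) /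
        2 := by
    rw [← hφ2]
    ring
  simp only [theta, e5, e6]
  rw [hz, ha, hc, d4, d5, d2, d3, ← d6]
  rw [← d6] at d1 hsq
  linear_combination qPochInf q (q ^ 4) * qPochInf (q ^ 3) (q ^ 4) *
    (qPochInf (-q) (q ^ 4) * qPochInf (-q ^ 3) (q ^ 4)) * hsq -
    (qPochInf (q ^ 8) (q ^ 8) * qPochInf (q ^ 3) (q ^ 8) * qPochInf (q ^ 5) (q ^ 8)) ^ 2 * d1

lemma tsum_nahmTerm_zero : ∑' n : Fin 6 → ℕ, nahmTerm 0 n = 1 := by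
  rw [tsum_eq_single 0]
  · simp [nahmTerm, nahmForm, qPoch]
  · intro n hn
    have h : nahmForm n ≠ 0 := by
      contrapose! hn
      have hle := le_nahmForm n
      rw [hn] at hle
      funext i
      fin_cases i <;> simp only [Fin.zero_eta, Fin.mk_one, Fin.reduceFinMk, Pi.zero_apply] <;> omega
    rw [nahmTerm, zero_pow h, zero_div]

lemma qPochInf_zero_zero : qPochInf 0 0 = 1 := by
  simp [qPochInf]

end

/-- The Nahm-type formula for the `𝒲₃(3,8)` character `χ̃_{2,2}^8`
(equation (7.6), Tsuchioka's conjecture, of the paper). -/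
theorem tsuchioka_nahm_formula (q : ℂ) (hq : ‖q‖ < 1) :
    qPochInf (q ^ 8) (q ^ 8) ^ 2 / qPochInf q q ^ 2 *
        (theta (q ^ 3) (q ^ 8) * theta (q ^ 3) (q ^ 8) * theta (q ^ 6) (q ^ 8)) =
      ∑' n : Fin 6 → ℕ,
        q ^ (n 0 ^ 2 + n 1 ^ 2 + 2 * n 2 ^ 2 + 2 * n 3 ^ 2 + 3 * n 4 ^ 2 + 4 * n 5 ^ 2 +
              n 0 * n 1 + 2 * n 0 * n 2 + 2 * n 0 * n 3 + 2 * n 0 * n 4 + 2 * n 0 * n 5 +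
              n 1 * n 2 + 2 * n 1 * n 3 + 2 * n 1 * n 4 + 3 * n 1 * n 5 +
              3 * n 2 * n 3 + 4 * n 2 * n 4 + 4 * n 2 * n 5 +
              4 * n 3 * n 4 + 5 * n 3 * n 5 + 6 * n 4 * n 5) /
          (qPoch q q (n 0) * qPoch q q (n 1) * qPoch q q (n 2) * qPoch q q (n 3) *
            qPoch q q (n 4) * qPoch q q (n 5)) := by
  change _ = ∑' n : Fin 6 → ℕ, nahmTerm q n
  obtain rfl | h0 := eq_or_ne q 0
  · rw [tsum_nahmTerm_zero]
    simp [theta, qPochInf_zero_zero]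
  · have hne := qPochInf_self_ne_zero hq
    have h := qPochInf_mul_theta hq h0
    rw [← tsum_axes hq, ← qPochInf_mul_tsum_nahmTerm hq] at h
    rw [div_mul_eq_mul_div, h]
    field_simp

end Stmt19
end
end
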